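/- arXiv:2109.06423 — 2 statements merged into one kernel-verified Lean document; each statement's English description precedes it below -/
import Mathlib

section
/- Let Q be a family of 011-PI kernels of size (n0,n1)×(n0,n1) whose diagonal 1D-PI families have the symmetric form Q11 = (Qxx⁰, Qxx¹, Qxx¹) on [a,b] and Q22 = (Qyy⁰, Qyy¹, Qyy¹) on [c,d]. Suppose there exist q ∈ ℕ, a continuous Z : ℝ → ℝ^{q×n1}, and constant matrices H0x, H0y ∈ ℝ^{n0×q}, Hx0, Hy0 ∈ ℝ^{q×n0}, Γxx, Γxy, Γyx, Γyy ∈ ℝ^{q×q} such that Q01(x) = H0x·Z(x), Q02(y) = H0y·Z(y), Q10(x) = Z(x)ᵀ·Hx0, Q20(y) = Z(y)ᵀ·Hy0, Qxx¹(x,θ) = Z(x)ᵀ·Γxx·Z(θ), Q12(x,y) = Z(x)ᵀ·Γxy·Z(y), Q21(y,x) = Z(y)ᵀ·Γyx·Z(x), and Qyy¹(y,ν) = Z(y)ᵀ·Γyy·Z(ν). Assume the matrix Q00 is invertible, Qxx⁰(x) is invertible for every x ∈ [a,b], and Qyy⁰(y) is invertible for every y ∈ [c,d]. Set Kxx = ∫_a^b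 Z(x)(Qxx⁰(x))⁻¹Z(x)ᵀ dx, Kyy = ∫_c^d Z(y)(Qyy⁰(y))⁻¹Z(y)ᵀ dy, Πxx = Γxx − Hx0·Q00⁻¹·H0x, Πxy = Γxy − Hx0·Q00⁻¹·H0y, Πyx = Γyx − Hy0·Q00⁻¹·H0x, Πyy = Γyy − Hy0·Q00⁻¹·H0y, Σx = I + Kxx·Πxx, Σy = I + Kyy·Πyy, and assume Σx, Σy, Σx − Kxx·Πxy·Σy⁻¹·Kyy·Πyx, and Σy − Kyy·Πyx·Σx⁻¹·Kxx·Πxy are all invertible. Then there exists a family Q̂ of 011-PI kernels of size (n0,n1)×(n0,n1) such that for every triple (v, u1, u2) with v ∈ ℝ^{n0} and continuous u1 : [a,b] → ℝ^{n1}, u2 : [c,d] → ℝ^{n1}, both P[Q̂](P[Q](v,u1,u2)) = (v,u1,u2) and P[Q](P[Q̂](v,u1,u2)) = (v,u1,u2). -/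
open Matrix MeasureTheory Set

noncomputable section

/-- A family of 1D-PI kernels of size `p × r` (the parameters of a 1D-PI operator). -/
structure PI1DK (p r : ℕ) where
  k0 : ℝ → Matrix (Fin p) (Fin r) ℝ
  k1 : ℝ → ℝ → Matrix (Fin p) (Fin r) ℝ
  k2 : ℝ → ℝ → Matrix (Fin p) (Fin r) ℝ

/-- Continuity of a family of 1D-PI kernels on the interval `[s,t]`. -/
def PI1DK.IsCont {p r : ℕ} (s t : ℝ) (N : PI1DK p r) : Prop :=
  ContinuousOn N.k0 (Icc s t) ∧
  ContinuousOn (fun q : ℝ × ℝ => N.k1 q.1 q.2) (Icc s t ×ˢ Icc s t) ∧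
  ContinuousOn (fun q : ℝ × ℝ => N.k2 q.1 q.2) (Icc s t ×ˢ Icc s t)

/-- The 1D-PI operator on `[s,t]` associated with the kernels `N`. -/
def PI1D {p r : ℕ} (s t : ℝ) (N : PI1DK p r) (u : ℝ → Fin r → ℝ) (x : ℝ) :
    Fin p → ℝ :=
  N.k0 x *ᵥ u x + (∫ θ in s..x, N.k1 x θ *ᵥ u θ) + (∫ θ in x..t, N.k2 x θ *ᵥ u θ)

/-- Entrywise interval integral of a matrix-valued function. -/
def mInt {p r : ℕ} (s t : ℝ) (F : ℝ → Matrix (Fin p) (Fin r) ℝ) :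
    Matrix (Fin p) (Fin r) ℝ :=
  Matrix.of fun i j => ∫ η in s..t, F η i j

/-- A family of 2D-PI kernels of size `p × r`. -/
structure PI2DK (p r : ℕ) where
  k00 : ℝ → ℝ → Matrix (Fin p) (Fin r) ℝ
  k10 : ℝ → ℝ → ℝ → Matrix (Fin p) (Fin r) ℝ
  k20 : ℝ → ℝ → ℝ → Matrix (Fin p) (Fin r) ℝ
  k01 : ℝ → ℝ → ℝ → Matrix (Fin p) (Fin r) ℝ
  k02 : ℝ → ℝ → ℝ → Matrix (Fin p) (Fin r) ℝ
  k11 : ℝ → ℝ → ℝ → ℝ → Matrix (Fin p) (Fin r) ℝ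
  k21 : ℝ → ℝ → ℝ → ℝ → Matrix (Fin p) (Fin r) ℝ
  k12 : ℝ → ℝ → ℝ → ℝ → Matrix (Fin p) (Fin r) ℝ
  k22 : ℝ → ℝ → ℝ → ℝ → Matrix (Fin p) (Fin r) ℝ

/-- Continuity of a family of 2D-PI kernels on `[a,b] × [c,d]`. -/
def PI2DK.IsCont {p r : ℕ} (a b c d : ℝ) (N : PI2DK p r) : Prop :=
  ContinuousOn (fun q : ℝ × ℝ => N.k00 q.1 q.2) (Icc a b ×ˢ Icc c d) ∧
  ContinuousOn (fun q : ℝ × ℝ × ℝ => N.k10 q.1 q.2.1 q.2.2)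
    (Icc a b ×ˢ Icc c d ×ˢ Icc a b) ∧
  ContinuousOn (fun q : ℝ × ℝ × ℝ => N.k20 q.1 q.2.1 q.2.2)
    (Icc a b ×ˢ Icc c d ×ˢ Icc a b) ∧
  ContinuousOn (fun q : ℝ × ℝ × ℝ => N.k01 q.1 q.2.1 q.2.2)
    (Icc a b ×ˢ Icc c d ×ˢ Icc c d) ∧
  ContinuousOn (fun q : ℝ × ℝ × ℝ => N.k02 q.1 q.2.1 q.2.2)
    (Icc a b ×ˢ Icc c d ×ˢ Icc c d) ∧
  ContinuousOn (fun q : ℝ × ℝ × ℝ × ℝ => N.k11 q.1 q.2.1 q.2.2.1 q.2.2.2)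
    (Icc a b ×ˢ Icc c d ×ˢ Icc a b ×ˢ Icc c d) ∧
  ContinuousOn (fun q : ℝ × ℝ × ℝ × ℝ => N.k21 q.1 q.2.1 q.2.2.1 q.2.2.2)
    (Icc a b ×ˢ Icc c d ×ˢ Icc a b ×ˢ Icc c d) ∧
  ContinuousOn (fun q : ℝ × ℝ × ℝ × ℝ => N.k12 q.1 q.2.1 q.2.2.1 q.2.2.2)
    (Icc a b ×ˢ Icc c d ×ˢ Icc a b ×ˢ Icc c d) ∧
  ContinuousOn (fun q : ℝ × ℝ × ℝ × ℝ => N.k22 q.1 q.2.1 q.2.2.1 q.2.2.2)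
    (Icc a b ×ˢ Icc c d ×ˢ Icc a b ×ˢ Icc c d)

/-- The 2D-PI operator on `[a,b] × [c,d]` associated with the kernels `N`. -/
def PI2D {p r : ℕ} (a b c d : ℝ) (N : PI2DK p r) (u : ℝ → ℝ → Fin r → ℝ)
    (x y : ℝ) : Fin p → ℝ :=
  N.k00 x y *ᵥ u x y
  + (∫ θ in a..x, N.k10 x y θ *ᵥ u θ y)
  + (∫ θ in x..b, N.k20 x y θ *ᵥ u θ y)
  + (∫ ν in c..y, N.k01 x y ν *ᵥ u x ν)
  + (∫ ν in y..d, N.k02 x y ν *ᵥ u x ν)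
  + (∫ θ in a..x, ∫ ν in c..y, N.k11 x y θ ν *ᵥ u θ ν)
  + (∫ θ in x..b, ∫ ν in c..y, N.k21 x y θ ν *ᵥ u θ ν)
  + (∫ θ in a..x, ∫ ν in y..d, N.k12 x y θ ν *ᵥ u θ ν)
  + (∫ θ in x..b, ∫ ν in y..d, N.k22 x y θ ν *ᵥ u θ ν)

/-- A family of 011-PI kernels of size `(p0,p1) × (r0,r1)`. -/
structure PI011K (p0 p1 r0 r1 : ℕ) where
  b00 : Matrix (Fin p0) (Fin r0) ℝ
  b01 : ℝ → Matrix (Fin p0) (Fin r1) ℝ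
  b02 : ℝ → Matrix (Fin p0) (Fin r1) ℝ
  b10 : ℝ → Matrix (Fin p1) (Fin r0) ℝ
  b20 : ℝ → Matrix (Fin p1) (Fin r0) ℝ
  b12 : ℝ → ℝ → Matrix (Fin p1) (Fin r1) ℝ
  b21 : ℝ → ℝ → Matrix (Fin p1) (Fin r1) ℝ
  b11 : PI1DK p1 r1
  b22 : PI1DK p1 r1

/-- Continuity of a family of 011-PI kernels. -/
def PI011K.IsCont {p0 p1 r0 r1 : ℕ} (a b c d : ℝ) (B : PI011K p0 p1 r0 r1) : Prop :=
  ContinuousOn B.b01 (Icc a b) ∧ ContinuousOn B.b02 (Icc c d) ∧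
  ContinuousOn B.b10 (Icc a b) ∧ ContinuousOn B.b20 (Icc c d) ∧
  ContinuousOn (fun q : ℝ × ℝ => B.b12 q.1 q.2) (Icc a b ×ˢ Icc c d) ∧
  ContinuousOn (fun q : ℝ × ℝ => B.b21 q.1 q.2) (Icc c d ×ˢ Icc a b) ∧
  B.b11.IsCont a b ∧ B.b22.IsCont c d

/-- The 011-PI operator associated with the kernels `B`. -/
def PI011 {p0 p1 r0 r1 : ℕ} (a b c d : ℝ) (B : PI011K p0 p1 r0 r1)
    (v : Fin r0 → ℝ) (u1 u2 : ℝ → Fin r1 → ℝ) :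
    (Fin p0 → ℝ) × (ℝ → Fin p1 → ℝ) × (ℝ → Fin p1 → ℝ) :=
  ( B.b00 *ᵥ v + (∫ θ in a..b, B.b01 θ *ᵥ u1 θ) + (∫ ν in c..d, B.b02 ν *ᵥ u2 ν),
    fun x => B.b10 x *ᵥ v + PI1D a b B.b11 u1 x + (∫ ν in c..d, B.b12 x ν *ᵥ u2 ν),
    fun y => B.b20 y *ᵥ v + (∫ θ in a..b, B.b21 y θ *ᵥ u1 θ) + PI1D c d B.b22 u2 y )

/-- A family of (2D→011)-PI kernels of size `(p0,p1) × r`. -/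
structure PI2Dto011K (p0 p1 r : ℕ) where
  d0 : ℝ → ℝ → Matrix (Fin p0) (Fin r) ℝ
  d10 : ℝ → ℝ → Matrix (Fin p1) (Fin r) ℝ
  d11 : ℝ → ℝ → ℝ → Matrix (Fin p1) (Fin r) ℝ
  d12 : ℝ → ℝ → ℝ → Matrix (Fin p1) (Fin r) ℝ
  d20 : ℝ → ℝ → Matrix (Fin p1) (Fin r) ℝ
  d21 : ℝ → ℝ → ℝ → Matrix (Fin p1) (Fin r) ℝ
  d22 : ℝ → ℝ → ℝ → Matrix (Fin p1) (Fin r) ℝ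

/-- Continuity of a family of (2D→011)-PI kernels. -/
def PI2Dto011K.IsCont {p0 p1 r : ℕ} (a b c d : ℝ) (D : PI2Dto011K p0 p1 r) : Prop :=
  ContinuousOn (fun q : ℝ × ℝ => D.d0 q.1 q.2) (Icc a b ×ˢ Icc c d) ∧
  ContinuousOn (fun q : ℝ × ℝ => D.d10 q.1 q.2) (Icc a b ×ˢ Icc c d) ∧
  ContinuousOn (fun q : ℝ × ℝ × ℝ => D.d11 q.1 q.2.1 q.2.2)
    (Icc a b ×ˢ Icc c d ×ˢ Icc a b) ∧
  ContinuousOn (fun q : ℝ × ℝ × ℝ => D.d12 q.1 q.2.1 q.2.2)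
    (Icc a b ×ˢ Icc c d ×ˢ Icc a b) ∧
  ContinuousOn (fun q : ℝ × ℝ => D.d20 q.1 q.2) (Icc a b ×ˢ Icc c d) ∧
  ContinuousOn (fun q : ℝ × ℝ × ℝ => D.d21 q.1 q.2.1 q.2.2)
    (Icc a b ×ˢ Icc c d ×ˢ Icc c d) ∧
  ContinuousOn (fun q : ℝ × ℝ × ℝ => D.d22 q.1 q.2.1 q.2.2)
    (Icc a b ×ˢ Icc c d ×ˢ Icc c d)

/-- The (2D→011)-PI operator associated with the kernels `D`. -/
def PI2Dto011 {p0 p1 r : ℕ} (a b c d : ℝ) (D : PI2Dto011K p0 p1 r)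
    (u : ℝ → ℝ → Fin r → ℝ) :
    (Fin p0 → ℝ) × (ℝ → Fin p1 → ℝ) × (ℝ → Fin p1 → ℝ) :=
  ( ∫ θ in a..b, ∫ ν in c..d, D.d0 θ ν *ᵥ u θ ν,
    fun x => ∫ y in c..d,
      (D.d10 x y *ᵥ u x y + (∫ θ in a..x, D.d11 x y θ *ᵥ u θ y)
        + (∫ θ in x..b, D.d12 x y θ *ᵥ u θ y)),
    fun y => ∫ x in a..b,
      (D.d20 x y *ᵥ u x y + (∫ ν in c..y, D.d21 x y ν *ᵥ u x ν)
        + (∫ ν in y..d, D.d22 x y ν *ᵥ u x ν)) )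

/-- A family of (011→2D)-PI kernels of size `p × (r0,r1)`. -/
structure PI011to2DK (p r0 r1 : ℕ) where
  e0 : ℝ → ℝ → Matrix (Fin p) (Fin r0) ℝ
  e10 : ℝ → ℝ → Matrix (Fin p) (Fin r1) ℝ
  e11 : ℝ → ℝ → ℝ → Matrix (Fin p) (Fin r1) ℝ
  e12 : ℝ → ℝ → ℝ → Matrix (Fin p) (Fin r1) ℝ
  e20 : ℝ → ℝ → Matrix (Fin p) (Fin r1) ℝ
  e21 : ℝ → ℝ → ℝ → Matrix (Fin p) (Fin r1) ℝ
  e22 : ℝ → ℝ → ℝ → Matrix (Fin p) (Fin r1) ℝ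

/-- Continuity of a family of (011→2D)-PI kernels. -/
def PI011to2DK.IsCont {p r0 r1 : ℕ} (a b c d : ℝ) (E : PI011to2DK p r0 r1) : Prop :=
  ContinuousOn (fun q : ℝ × ℝ => E.e0 q.1 q.2) (Icc a b ×ˢ Icc c d) ∧
  ContinuousOn (fun q : ℝ × ℝ => E.e10 q.1 q.2) (Icc a b ×ˢ Icc c d) ∧
  ContinuousOn (fun q : ℝ × ℝ × ℝ => E.e11 q.1 q.2.1 q.2.2)
    (Icc a b ×ˢ Icc c d ×ˢ Icc a b) ∧
  ContinuousOn (fun q : ℝ × ℝ × ℝ => E.e12 q.1 q.2.1 q.2.2)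
    (Icc a b ×ˢ Icc c d ×ˢ Icc a b) ∧
  ContinuousOn (fun q : ℝ × ℝ => E.e20 q.1 q.2) (Icc a b ×ˢ Icc c d) ∧
  ContinuousOn (fun q : ℝ × ℝ × ℝ => E.e21 q.1 q.2.1 q.2.2)
    (Icc a b ×ˢ Icc c d ×ˢ Icc c d) ∧
  ContinuousOn (fun q : ℝ × ℝ × ℝ => E.e22 q.1 q.2.1 q.2.2)
    (Icc a b ×ˢ Icc c d ×ˢ Icc c d)

/-- The (011→2D)-PI operator associated with the kernels `E`. -/
def PI011to2D {p r0 r1 : ℕ} (a b c d : ℝ) (E : PI011to2DK p r0 r1)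
    (v : Fin r0 → ℝ) (u1 u2 : ℝ → Fin r1 → ℝ) (x y : ℝ) : Fin p → ℝ :=
  E.e0 x y *ᵥ v + E.e10 x y *ᵥ u1 x
  + (∫ θ in a..x, E.e11 x y θ *ᵥ u1 θ) + (∫ θ in x..b, E.e12 x y θ *ᵥ u1 θ)
  + E.e20 x y *ᵥ u2 y
  + (∫ ν in c..y, E.e21 x y ν *ᵥ u2 ν) + (∫ ν in y..d, E.e22 x y ν *ᵥ u2 ν)

section Continuity

variable {X : Type*} [TopologicalSpace X] {s : Set X} {l m n : Type*}

theorem ContinuousOn.matrix_mul' [Fintype m] {A : X → Matrix l m ℝ} {B : X → Matrix m n ℝ}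
    (hA : ContinuousOn A s) (hB : ContinuousOn B s) :
    ContinuousOn (fun x => A x * B x) s :=
  (continuous_fst.matrix_mul continuous_snd :
    Continuous fun p : Matrix l m ℝ × Matrix m n ℝ => p.1 * p.2).comp_continuousOn (hA.prodMk hB)

theorem ContinuousOn.matrix_mulVec' [Fintype m] {A : X → Matrix l m ℝ} {v : X → m → ℝ}
    (hA : ContinuousOn A s) (hv : ContinuousOn v s) :
    ContinuousOn (fun x => A x *ᵥ v x) s :=
  (continuous_fst.matrix_mulVec continuous_snd :
    Continuous fun p : Matrix l m ℝ × (m → ℝ) => p.1 *ᵥ p.2).comp_continuousOn (hA.prodMk hv)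

theorem ContinuousOn.matrix_nonsing_inv [Fintype n] [DecidableEq n] {A : X → Matrix n n ℝ}
    (hA : ContinuousOn A s) (hu : ∀ x ∈ s, IsUnit (A x)) :
    ContinuousOn (fun x => (A x)⁻¹) s := by
  have hdet : ContinuousOn (fun x => (A x).det) s :=
    (continuous_id.matrix_det).comp_continuousOn hA
  have hadj : ContinuousOn (fun x => (A x).adjugate) s :=
    (continuous_id.matrix_adjugate).comp_continuousOn hA
  have hinv : ContinuousOn (fun x => ((A x).det)⁻¹) s :=
    hdet.inv₀ fun x hx => ((Matrix.isUnit_iff_isUnit_det _).1 (hu x hx)).ne_zero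
  refine (hinv.smul hadj).congr fun x _ => ?_
  simp [Matrix.inv_def]

end Continuity

section Integrals

variable {l m n : Type*} [Fintype m] [Fintype n] {s t : ℝ}

/-- A constant matrix can be pulled out of an integral of vectors. -/
theorem intervalIntegral_const_mulVec [Fintype l] (A : Matrix l m ℝ) {f : ℝ → m → ℝ}
    (hf : IntervalIntegrable f volume s t) :
    ∫ x in s..t, A *ᵥ f x = A *ᵥ ∫ x in s..t, f x :=
  (LinearMap.toContinuousLinearMap A.mulVecLin).intervalIntegral_comp_comm hf

/-- A constant vector can be pulled out of an integral of matrices. -/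
theorem intervalIntegral_mulVec_const {F : ℝ → Matrix m n ℝ}
    (hst : s ≤ t) (hF : ContinuousOn F (Icc s t)) (v : n → ℝ) :
    ∫ x in s..t, F x *ᵥ v = (Matrix.of fun i j => ∫ x in s..t, F x i j) *ᵥ v := by
  have hv : IntervalIntegrable (fun x => F x *ᵥ v) volume s t :=
    (ContinuousOn.matrix_mulVec' hF continuousOn_const).intervalIntegrable_of_Icc hst
  have hF' : ∀ i j, IntervalIntegrable (fun x => F x i j) volume s t := fun i j =>
    ((continuous_id.matrix_elem i j).comp_continuousOn hF).intervalIntegrable_of_Icc hst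
  funext i
  have h :=
    (ContinuousLinearMap.proj (R := ℝ) (φ := fun _ : m => ℝ) i).intervalIntegral_comp_comm hv
  simp only [ContinuousLinearMap.proj_apply] at h
  rw [← h]
  simp only [Matrix.mulVec, dotProduct, Matrix.of_apply]
  rw [intervalIntegral.integral_finsetSum fun j _ => (hF' i j).mul_const _]
  simp

end Integrals

/-- Data of a separable 011-PI operator
`(v, u) ↦ (M v + H0 m, D u + L (H1 v + G m))` with moments `m = ∫ R1 u1 + ∫ R2 u2`. -/
structure SeparableData (n0 n1 : ℕ) (κ : Type*) where
  M : Matrix (Fin n0) (Fin n0) ℝ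
  H0 : Matrix (Fin n0) κ ℝ
  H1 : Matrix κ (Fin n0) ℝ
  G : Matrix κ κ ℝ
  D1 : ℝ → Matrix (Fin n1) (Fin n1) ℝ
  L1 : ℝ → Matrix (Fin n1) κ ℝ
  R1 : ℝ → Matrix κ (Fin n1) ℝ
  D2 : ℝ → Matrix (Fin n1) (Fin n1) ℝ
  L2 : ℝ → Matrix (Fin n1) κ ℝ
  R2 : ℝ → Matrix κ (Fin n1) ℝ

namespace SeparableData

variable {n0 n1 : ℕ} {κ : Type*} [Fintype κ] {a b c d : ℝ}

/-- Continuity of the variable coefficients. -/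
structure IsCont (a b c d : ℝ) (S : SeparableData n0 n1 κ) : Prop where
  D1 : ContinuousOn S.D1 (Icc a b)
  L1 : ContinuousOn S.L1 (Icc a b)
  R1 : ContinuousOn S.R1 (Icc a b)
  D2 : ContinuousOn S.D2 (Icc c d)
  L2 : ContinuousOn S.L2 (Icc c d)
  R2 : ContinuousOn S.R2 (Icc c d)

/-- The 011-PI kernels with the given separable data. -/
def kernels (S : SeparableData n0 n1 κ) : PI011K n0 n1 n0 n1 where
  b00 := S.M
  b01 x := S.H0 * S.R1 x
  b02 y := S.H0 * S.R2 y
  b10 x := S.L1 x * S.H1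
  b20 y := S.L2 y * S.H1
  b12 x y := S.L1 x * S.G * S.R2 y
  b21 y x := S.L2 y * S.G * S.R1 x
  b11 := ⟨S.D1, fun x θ => S.L1 x * S.G * S.R1 θ, fun x θ => S.L1 x * S.G * S.R1 θ⟩
  b22 := ⟨S.D2, fun y ν => S.L2 y * S.G * S.R2 ν, fun y ν => S.L2 y * S.G * S.R2 ν⟩

theorem IsCont.kernels {S : SeparableData n0 n1 κ} (hS : S.IsCont a b c d) :
    S.kernels.IsCont a b c d := by
  have key : ∀ {s t s' t' : ℝ} {L : ℝ → Matrix (Fin n1) κ ℝ} {R : ℝ → Matrix κ (Fin n1) ℝ},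
      ContinuousOn L (Icc s t) → ContinuousOn R (Icc s' t') →
      ContinuousOn (fun p : ℝ × ℝ => L p.1 * S.G * R p.2) (Icc s t ×ˢ Icc s' t') :=
    fun hL hR => ((hL.comp continuousOn_fst fun _ h => h.1).matrix_mul'
      continuousOn_const).matrix_mul' (hR.comp continuousOn_snd fun _ h => h.2)
  exact ⟨continuousOn_const.matrix_mul' hS.R1, continuousOn_const.matrix_mul' hS.R2,
    hS.L1.matrix_mul' continuousOn_const, hS.L2.matrix_mul' continuousOn_const,
    key hS.L1 hS.R2, key hS.L2 hS.R1, ⟨hS.D1, key hS.L1 hS.R1, key hS.L1 hS.R1⟩,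
    ⟨hS.D2, key hS.L2 hS.R2, key hS.L2 hS.R2⟩⟩

/-- The kernels `B` agree with those of `S` on the relevant intervals. -/
structure Represents (a b c d : ℝ) (S : SeparableData n0 n1 κ) (B : PI011K n0 n1 n0 n1) :
    Prop where
  b00 : B.b00 = S.M
  b01 : ∀ x ∈ Icc a b, B.b01 x = S.H0 * S.R1 x
  b02 : ∀ y ∈ Icc c d, B.b02 y = S.H0 * S.R2 y
  b10 : ∀ x ∈ Icc a b, B.b10 x = S.L1 x * S.H1
  b20 : ∀ y ∈ Icc c d, B.b20 y = S.L2 y * S.H1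
  b12 : ∀ x ∈ Icc a b, ∀ y ∈ Icc c d, B.b12 x y = S.L1 x * S.G * S.R2 y
  b21 : ∀ y ∈ Icc c d, ∀ x ∈ Icc a b, B.b21 y x = S.L2 y * S.G * S.R1 x
  b11_k0 : ∀ x ∈ Icc a b, B.b11.k0 x = S.D1 x
  b11_k1 : ∀ x ∈ Icc a b, ∀ θ ∈ Icc a b, B.b11.k1 x θ = S.L1 x * S.G * S.R1 θ
  b11_k2 : ∀ x ∈ Icc a b, ∀ θ ∈ Icc a b, B.b11.k2 x θ = S.L1 x * S.G * S.R1 θ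
  b22_k0 : ∀ y ∈ Icc c d, B.b22.k0 y = S.D2 y
  b22_k1 : ∀ y ∈ Icc c d, ∀ ν ∈ Icc c d, B.b22.k1 y ν = S.L2 y * S.G * S.R2 ν
  b22_k2 : ∀ y ∈ Icc c d, ∀ ν ∈ Icc c d, B.b22.k2 y ν = S.L2 y * S.G * S.R2 ν

theorem represents_kernels (S : SeparableData n0 n1 κ) : S.Represents a b c d S.kernels := by
  constructor <;> intros <;> rfl

/-- The moments of `(u1, u2)`, on which the finite-rank part of the operator depends. -/
def moments (a b c d : ℝ) (S : SeparableData n0 n1 κ) (u1 u2 : ℝ → Fin n1 → ℝ) : κ → ℝ :=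
  (∫ x in a..b, S.R1 x *ᵥ u1 x) + ∫ y in c..d, S.R2 y *ᵥ u2 y

/-- An integral against a kernel that factors through `R` on `[s,t]`. -/
theorem integral_factor {p : ℕ} {s t : ℝ} (hst : s ≤ t) {F : ℝ → Matrix (Fin p) (Fin n1) ℝ}
    {A : Matrix (Fin p) κ ℝ} {R : ℝ → Matrix κ (Fin n1) ℝ} {u : ℝ → Fin n1 → ℝ}
    (hF : ∀ x ∈ Icc s t, F x = A * R x)
    (hR : ContinuousOn R (Icc s t)) (hu : ContinuousOn u (Icc s t)) :
    ∫ x in s..t, F x *ᵥ u x = A *ᵥ ∫ x in s..t, R x *ᵥ u x := by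
  rw [← intervalIntegral_const_mulVec A ((hR.matrix_mulVec' hu).intervalIntegrable_of_Icc hst)]
  refine intervalIntegral.integral_congr fun x hx => ?_
  rw [uIcc_of_le hst] at hx
  simp only [hF x hx, Matrix.mulVec_mulVec]

theorem PI1D_factor {s t x : ℝ} (hx : x ∈ Icc s t) {N : PI1DK n1 n1}
    {A : Matrix (Fin n1) κ ℝ} {R : ℝ → Matrix κ (Fin n1) ℝ} {u : ℝ → Fin n1 → ℝ}
    (hk1 : ∀ θ ∈ Icc s t, N.k1 x θ = A * R θ) (hk2 : ∀ θ ∈ Icc s t, N.k2 x θ = A * R θ)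
    (hR : ContinuousOn R (Icc s t)) (hu : ContinuousOn u (Icc s t)) :
    PI1D s t N u x = N.k0 x *ᵥ u x + A *ᵥ ∫ θ in s..t, R θ *ᵥ u θ := by
  have hl : Icc s x ⊆ Icc s t := Icc_subset_Icc_right hx.2
  have hr : Icc x t ⊆ Icc s t := Icc_subset_Icc_left hx.1
  have hc := hR.matrix_mulVec' hu
  rw [PI1D, integral_factor hx.1 (fun θ h => hk1 θ (hl h)) (hR.mono hl) (hu.mono hl),
    integral_factor hx.2 (fun θ h => hk2 θ (hr h)) (hR.mono hr) (hu.mono hr), add_assoc,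
    ← Matrix.mulVec_add, intervalIntegral.integral_add_adjacent_intervals
      ((hc.mono hl).intervalIntegrable_of_Icc hx.1) ((hc.mono hr).intervalIntegrable_of_Icc hx.2)]

variable {S T : SeparableData n0 n1 κ} {B C : PI011K n0 n1 n0 n1} {u1 u2 : ℝ → Fin n1 → ℝ}

theorem Represents.apply_fst (hB : S.Represents a b c d B) (hS : S.IsCont a b c d)
    (hab : a ≤ b) (hcd : c ≤ d) (v : Fin n0 → ℝ)
    (hu1 : ContinuousOn u1 (Icc a b)) (hu2 : ContinuousOn u2 (Icc c d)) :
    (PI011 a b c d B v u1 u2).1 = S.M *ᵥ v + S.H0 *ᵥ S.moments a b c d u1 u2 := by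
  simp only [PI011]
  rw [hB.b00, integral_factor hab hB.b01 hS.R1 hu1, integral_factor hcd hB.b02 hS.R2 hu2,
    add_assoc, ← Matrix.mulVec_add, moments]

theorem Represents.apply_snd_fst (hB : S.Represents a b c d B) (hS : S.IsCont a b c d)
    (hcd : c ≤ d) (v : Fin n0 → ℝ)
    (hu1 : ContinuousOn u1 (Icc a b)) (hu2 : ContinuousOn u2 (Icc c d)) {x : ℝ}
    (hx : x ∈ Icc a b) :
    (PI011 a b c d B v u1 u2).2.1 x =
      S.D1 x *ᵥ u1 x + S.L1 x *ᵥ (S.H1 *ᵥ v + S.G *ᵥ S.moments a b c d u1 u2) := by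
  simp only [PI011]
  rw [hB.b10 x hx, PI1D_factor hx (hB.b11_k1 x hx) (hB.b11_k2 x hx) hS.R1 hu1,
    hB.b11_k0 x hx, integral_factor hcd (hB.b12 x hx) hS.R2 hu2]
  simp only [moments, Matrix.mulVec_add, Matrix.mulVec_mulVec]
  abel

theorem Represents.apply_snd_snd (hB : S.Represents a b c d B) (hS : S.IsCont a b c d)
    (hab : a ≤ b) (v : Fin n0 → ℝ)
    (hu1 : ContinuousOn u1 (Icc a b)) (hu2 : ContinuousOn u2 (Icc c d)) {y : ℝ}
    (hy : y ∈ Icc c d) :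
    (PI011 a b c d B v u1 u2).2.2 y =
      S.D2 y *ᵥ u2 y + S.L2 y *ᵥ (S.H1 *ᵥ v + S.G *ᵥ S.moments a b c d u1 u2) := by
  simp only [PI011]
  rw [hB.b20 y hy, PI1D_factor hy (hB.b22_k1 y hy) (hB.b22_k2 y hy) hS.R2 hu2,
    hB.b22_k0 y hy, integral_factor hab (hB.b21 y hy) hS.R1 hu1]
  simp only [moments, Matrix.mulVec_add, Matrix.mulVec_mulVec]
  abel

/-- Algebraic relations under which the operator of `T` is a left inverse of that of `S`. -/
structure IsLeftInverse [DecidableEq κ] (a b c d : ℝ) (T S : SeparableData n0 n1 κ)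
    (K : Matrix κ κ ℝ) : Prop where
  D1 : ∀ x ∈ Icc a b, T.D1 x * S.D1 x = 1
  L1 : ∀ x ∈ Icc a b, T.L1 x = T.D1 x * S.L1 x
  R1 : ∀ x ∈ Icc a b, T.R1 x * S.D1 x = S.R1 x
  D2 : ∀ y ∈ Icc c d, T.D2 y * S.D2 y = 1
  L2 : ∀ y ∈ Icc c d, T.L2 y = T.D2 y * S.L2 y
  R2 : ∀ y ∈ Icc c d, T.R2 y * S.D2 y = S.R2 y
  gram : ∀ ξ : κ → ℝ, (∫ x in a..b, (T.R1 x * S.L1 x) *ᵥ ξ) +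
    (∫ y in c..d, (T.R2 y * S.L2 y) *ᵥ ξ) = K *ᵥ ξ
  block00 : T.M * S.M + T.H0 * K * S.H1 = 1
  block01 : T.M * S.H0 + T.H0 * (1 + K * S.G) = 0
  block10 : S.H1 + T.H1 * S.M + T.G * K * S.H1 = 0
  block11 : S.G + T.H1 * S.H0 + T.G * (1 + K * S.G) = 0

/-- Integrating `R' (D u + L ξ)` when `R' D = R`. -/
theorem integral_moment {s t : ℝ} (hst : s ≤ t) {D : ℝ → Matrix (Fin n1) (Fin n1) ℝ}
    {L : ℝ → Matrix (Fin n1) κ ℝ} {R R' : ℝ → Matrix κ (Fin n1) ℝ} {u w : ℝ → Fin n1 → ℝ}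
    {ξ : κ → ℝ} (hL : ContinuousOn L (Icc s t)) (hR : ContinuousOn R (Icc s t))
    (hR' : ContinuousOn R' (Icc s t)) (hu : ContinuousOn u (Icc s t))
    (hRD : ∀ x ∈ Icc s t, R' x * D x = R x)
    (hw : ∀ x ∈ Icc s t, w x = D x *ᵥ u x + L x *ᵥ ξ) :
    ∫ x in s..t, R' x *ᵥ w x = (∫ x in s..t, R x *ᵥ u x) + ∫ x in s..t, (R' x * L x) *ᵥ ξ := by
  rw [← intervalIntegral.integral_add
    ((hR.matrix_mulVec' hu).intervalIntegrable_of_Icc hst)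
    (((hR'.matrix_mul' hL).matrix_mulVec' continuousOn_const).intervalIntegrable_of_Icc hst)]
  refine intervalIntegral.integral_congr fun x hx => ?_
  rw [uIcc_of_le hst] at hx
  simp only [hw x hx, Matrix.mulVec_add, Matrix.mulVec_mulVec, hRD x hx]

theorem IsLeftInverse.apply_apply [DecidableEq κ] {K : Matrix κ κ ℝ}
    (h : IsLeftInverse a b c d T S K)
    (hC : T.Represents a b c d C) (hB : S.Represents a b c d B)
    (hT : T.IsCont a b c d) (hS : S.IsCont a b c d) (hab : a ≤ b) (hcd : c ≤ d)
    (v : Fin n0 → ℝ) (hu1 : ContinuousOn u1 (Icc a b)) (hu2 : ContinuousOn u2 (Icc c d)) :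
    (PI011 a b c d C (PI011 a b c d B v u1 u2).1
        (PI011 a b c d B v u1 u2).2.1 (PI011 a b c d B v u1 u2).2.2).1 = v ∧
      (∀ x ∈ Icc a b, (PI011 a b c d C (PI011 a b c d B v u1 u2).1
        (PI011 a b c d B v u1 u2).2.1 (PI011 a b c d B v u1 u2).2.2).2.1 x = u1 x) ∧
      (∀ y ∈ Icc c d, (PI011 a b c d C (PI011 a b c d B v u1 u2).1
        (PI011 a b c d B v u1 u2).2.1 (PI011 a b c d B v u1 u2).2.2).2.2 y = u2 y) := by
  have hw := hB.apply_fst hS hab hcd v hu1 hu2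
  have hw1 := fun x hx => hB.apply_snd_fst hS hcd v hu1 hu2 (x := x) hx
  have hw2 := fun y hy => hB.apply_snd_snd hS hab v hu1 hu2 (y := y) hy
  set w := (PI011 a b c d B v u1 u2).1
  set w1 := (PI011 a b c d B v u1 u2).2.1
  set w2 := (PI011 a b c d B v u1 u2).2.2
  set m := S.moments a b c d u1 u2 with hm
  set ξ := S.H1 *ᵥ v + S.G *ᵥ m with hξ
  have hw1c : ContinuousOn w1 (Icc a b) := ((hS.D1.matrix_mulVec' hu1).add
    (hS.L1.matrix_mulVec' continuousOn_const)).congr hw1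
  have hw2c : ContinuousOn w2 (Icc c d) := ((hS.D2.matrix_mulVec' hu2).add
    (hS.L2.matrix_mulVec' continuousOn_const)).congr hw2
  have hmom : T.moments a b c d w1 w2 = m + K *ᵥ ξ := by
    rw [moments, integral_moment hab hS.L1 hS.R1 hT.R1 hu1 h.R1 hw1,
      integral_moment hcd hS.L2 hS.R2 hT.R2 hu2 h.R2 hw2, ← h.gram, hm, moments]
    abel
  have hzero : ξ + (T.H1 *ᵥ w + T.G *ᵥ (m + K *ᵥ ξ)) = 0 := by
    have h0 := congrArg (· *ᵥ v) h.block10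
    have h1 := congrArg (· *ᵥ m) h.block11
    have h2 := congrArg₂ (· + ·) h0 h1
    simp only [Matrix.add_mulVec, Matrix.zero_mulVec, Matrix.mul_add, Matrix.mul_one,
      Matrix.mul_assoc, add_zero] at h2
    rw [← h2, hw, hξ]
    simp only [Matrix.mulVec_add, Matrix.mulVec_mulVec]
    abel
  refine ⟨?_, fun x hx => ?_, fun y hy => ?_⟩
  · rw [hC.apply_fst hT hab hcd w hw1c hw2c, hmom]
    have h0 := congrArg (· *ᵥ v) h.block00
    have h1 := congrArg (· *ᵥ m) h.block01
    have h2 := congrArg₂ (· + ·) h0 h1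
    simp only [Matrix.add_mulVec, Matrix.zero_mulVec, Matrix.mul_add, Matrix.mul_one,
      Matrix.one_mulVec, Matrix.mul_assoc, add_zero] at h2
    refine Eq.trans ?_ h2
    rw [hw, hξ]
    simp only [Matrix.mulVec_add, Matrix.mulVec_mulVec]
    abel
  · rw [hC.apply_snd_fst hT hcd w hw1c hw2c hx, hmom, hw1 x hx, h.L1 x hx, Matrix.mulVec_add,
      Matrix.mulVec_mulVec, h.D1 x hx, Matrix.one_mulVec, Matrix.mulVec_mulVec, add_assoc,
      ← Matrix.mulVec_add, hzero, Matrix.mulVec_zero, add_zero]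
  · rw [hC.apply_snd_snd hT hab w hw1c hw2c hy, hmom, hw2 y hy, h.L2 y hy, Matrix.mulVec_add,
      Matrix.mulVec_mulVec, h.D2 y hy, Matrix.one_mulVec, Matrix.mulVec_mulVec, add_assoc,
      ← Matrix.mulVec_add, hzero, Matrix.mulVec_zero, add_zero]

/-- Data of the inverse operator; `K` is the Gram matrix `∫ R1 D1⁻¹ L1 + ∫ R2 D2⁻¹ L2`. -/
def inverse [DecidableEq κ] (S : SeparableData n0 n1 κ) (K : Matrix κ κ ℝ) :
    SeparableData n0 n1 κ :=
  let P := S.G - S.H1 * S.M⁻¹ * S.H0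
  let W := (1 + K * P)⁻¹
  { M := S.M⁻¹ + S.M⁻¹ * S.H0 * W * K * S.H1 * S.M⁻¹
    H0 := -(S.M⁻¹ * S.H0 * W)
    H1 := -((1 - P * W * K) * S.H1 * S.M⁻¹)
    G := -(P * W)
    D1 := fun x => (S.D1 x)⁻¹
    L1 := fun x => (S.D1 x)⁻¹ * S.L1 x
    R1 := fun x => S.R1 x * (S.D1 x)⁻¹
    D2 := fun y => (S.D2 y)⁻¹
    L2 := fun y => (S.D2 y)⁻¹ * S.L2 y
    R2 := fun y => S.R2 y * (S.D2 y)⁻¹ }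

section Inverse

variable [DecidableEq κ] {K : Matrix κ κ ℝ}

theorem IsCont.inverse (hS : S.IsCont a b c d) (hD1 : ∀ x ∈ Icc a b, IsUnit (S.D1 x))
    (hD2 : ∀ y ∈ Icc c d, IsUnit (S.D2 y)) : (S.inverse K).IsCont a b c d :=
  have h1 := hS.D1.matrix_nonsing_inv hD1
  have h2 := hS.D2.matrix_nonsing_inv hD2
  ⟨h1, h1.matrix_mul' hS.L1, hS.R1.matrix_mul' h1, h2, h2.matrix_mul' hS.L2,
    hS.R2.matrix_mul' h2⟩

theorem inverse_isLeftInverse (hM : IsUnit S.M) (hD1 : ∀ x ∈ Icc a b, IsUnit (S.D1 x))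
    (hD2 : ∀ y ∈ Icc c d, IsUnit (S.D2 y))
    (hW : IsUnit (1 + K * (S.G - S.H1 * S.M⁻¹ * S.H0)))
    (hK : ∀ ξ : κ → ℝ, (∫ x in a..b, (S.R1 x * (S.D1 x)⁻¹ * S.L1 x) *ᵥ ξ) +
      (∫ y in c..d, (S.R2 y * (S.D2 y)⁻¹ * S.L2 y) *ᵥ ξ) = K *ᵥ ξ) :
    IsLeftInverse a b c d (S.inverse K) S K := by
  have hMi : S.M⁻¹ * S.M = 1 := Matrix.nonsing_inv_mul _ ((Matrix.isUnit_iff_isUnit_det _).1 hM)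
  have hD1i : ∀ x ∈ Icc a b, (S.D1 x)⁻¹ * S.D1 x = 1 := fun x hx =>
    Matrix.nonsing_inv_mul _ ((Matrix.isUnit_iff_isUnit_det _).1 (hD1 x hx))
  have hD2i : ∀ y ∈ Icc c d, (S.D2 y)⁻¹ * S.D2 y = 1 := fun y hy =>
    Matrix.nonsing_inv_mul _ ((Matrix.isUnit_iff_isUnit_det _).1 (hD2 y hy))
  have hWi := Matrix.nonsing_inv_mul _ ((Matrix.isUnit_iff_isUnit_det _).1 hW)
  constructor
  · exact hD1i
  · exact fun _ _ => rfl
  · exact fun x hx => by simp only [inverse, Matrix.mul_assoc, hD1i x hx, Matrix.mul_one]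
  · exact hD2i
  · exact fun _ _ => rfl
  · exact fun y hy => by simp only [inverse, Matrix.mul_assoc, hD2i y hy, Matrix.mul_one]
  · exact hK
  all_goals
    simp only [inverse]
    obtain ⟨P, hP⟩ : ∃ P, P = S.G - S.H1 * S.M⁻¹ * S.H0 := ⟨_, rfl⟩
    rw [← hP] at hWi ⊢
    set W := (1 + K * P)⁻¹
    have hG : S.G = P + S.H1 * S.M⁻¹ * S.H0 := by rw [hP]; abel
    have hWKP : W * (K * P) = 1 - W := by rw [← hWi, Matrix.mul_add, Matrix.mul_one]; abel
    try rw [hG]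
    simp only [Matrix.mul_add, Matrix.add_mul, Matrix.mul_sub, Matrix.sub_mul, Matrix.neg_mul,
      Matrix.mul_assoc, hMi, hWKP, Matrix.mul_one, Matrix.one_mul]
    abel

theorem isLeftInverse_inverse (hM : IsUnit S.M) (hD1 : ∀ x ∈ Icc a b, IsUnit (S.D1 x))
    (hD2 : ∀ y ∈ Icc c d, IsUnit (S.D2 y))
    (hW : IsUnit (1 + K * (S.G - S.H1 * S.M⁻¹ * S.H0)))
    (hK : ∀ ξ : κ → ℝ, (∫ x in a..b, (S.R1 x * (S.D1 x)⁻¹ * S.L1 x) *ᵥ ξ) +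
      (∫ y in c..d, (S.R2 y * (S.D2 y)⁻¹ * S.L2 y) *ᵥ ξ) = K *ᵥ ξ) :
    IsLeftInverse a b c d S (S.inverse K) K := by
  have hMdet := (Matrix.isUnit_iff_isUnit_det _).1 hM
  have hMi : S.M * S.M⁻¹ = 1 := Matrix.mul_nonsing_inv _ hMdet
  have hD1i : ∀ x ∈ Icc a b, S.D1 x * (S.D1 x)⁻¹ = 1 := fun x hx =>
    Matrix.mul_nonsing_inv _ ((Matrix.isUnit_iff_isUnit_det _).1 (hD1 x hx))
  have hD2i : ∀ y ∈ Icc c d, S.D2 y * (S.D2 y)⁻¹ = 1 := fun y hy =>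
    Matrix.mul_nonsing_inv _ ((Matrix.isUnit_iff_isUnit_det _).1 (hD2 y hy))
  have hWi := Matrix.mul_nonsing_inv _ ((Matrix.isUnit_iff_isUnit_det _).1 hW)
  constructor
  · exact hD1i
  · exact fun x hx => by simp only [inverse, ← Matrix.mul_assoc, hD1i x hx, Matrix.one_mul]
  · exact fun _ _ => rfl
  · exact hD2i
  · exact fun y hy => by simp only [inverse, ← Matrix.mul_assoc, hD2i y hy, Matrix.one_mul]
  · exact fun _ _ => rfl
  · simpa only [inverse, Matrix.mul_assoc] using hK
  all_goals
    simp only [inverse]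
    obtain ⟨P, hP⟩ : ∃ P, P = S.G - S.H1 * S.M⁻¹ * S.H0 := ⟨_, rfl⟩
    rw [← hP] at hWi ⊢
    set W := (1 + K * P)⁻¹
    have hG : S.G = P + S.H1 * S.M⁻¹ * S.H0 := by rw [hP]; abel
    have hKPW : K * (P * W) = 1 - W := by
      rw [← hWi, Matrix.add_mul, Matrix.one_mul, Matrix.mul_assoc]; abel
    have hKPW' : ∀ X : Matrix κ (Fin n0) ℝ, K * (P * (W * X)) = X - W * X := fun X => by
      rw [← Matrix.mul_assoc P, ← Matrix.mul_assoc K, hKPW, Matrix.sub_mul, Matrix.one_mul]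
    try rw [hG]
    simp only [Matrix.mul_add, Matrix.add_mul, Matrix.mul_sub, Matrix.sub_mul, Matrix.mul_neg,
      Matrix.mul_assoc, hMi, Matrix.mul_nonsing_inv_cancel_left _ _ hMdet, hKPW, hKPW',
      Matrix.mul_one, Matrix.one_mul]
    abel

end Inverse

/-- The separable data of a 011-PI operator
whose factors are `Zᵀ` and `Z` on both intervals. -/
def ofFactor {q : ℕ} (Q : PI011K n0 n1 n0 n1) (Z : ℝ → Matrix (Fin q) (Fin n1) ℝ)
    (H0x H0y : Matrix (Fin n0) (Fin q) ℝ) (Hx0 Hy0 : Matrix (Fin q) (Fin n0) ℝ)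
    (Gxx Gxy Gyx Gyy : Matrix (Fin q) (Fin q) ℝ) : SeparableData n0 n1 (Fin q ⊕ Fin q) where
  M := Q.b00
  H0 := fromCols H0x H0y
  H1 := fromRows Hx0 Hy0
  G := fromBlocks Gxx Gxy Gyx Gyy
  D1 := Q.b11.k0
  L1 x := fromCols (Z x)ᵀ 0
  R1 x := fromRows (Z x) 0
  D2 := Q.b22.k0
  L2 y := fromCols 0 (Z y)ᵀ
  R2 y := fromRows 0 (Z y)

end SeparableData

/-- Inversion of a separable 011-PI operator: under the stated
decomposition and invertibility assumptions, the 011-PI operator `P[Q]` has a two-sided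
inverse which is again a 011-PI operator. -/
theorem inverse_of_011_PI_operator {n0 n1 q : ℕ} (a b c d : ℝ)
    (hab : a < b) (hcd : c < d)
    (Q : PI011K n0 n1 n0 n1) (hQc : Q.IsCont a b c d)
    -- the diagonal 1D-PI families are symmetric (separable)
    (hsymx : Q.b11.k2 = Q.b11.k1) (hsymy : Q.b22.k2 = Q.b22.k1)
    -- separable decomposition of the off-diagonal parameters
    (Z : ℝ → Matrix (Fin q) (Fin n1) ℝ) (hZ : Continuous Z)
    (H0x H0y : Matrix (Fin n0) (Fin q) ℝ)
    (Hx0 Hy0 : Matrix (Fin q) (Fin n0) ℝ)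
    (Gxx Gxy Gyx Gyy : Matrix (Fin q) (Fin q) ℝ)
    (hQ01 : ∀ x ∈ Icc a b, Q.b01 x = H0x * Z x)
    (hQ02 : ∀ y ∈ Icc c d, Q.b02 y = H0y * Z y)
    (hQ10 : ∀ x ∈ Icc a b, Q.b10 x = (Z x)ᵀ * Hx0)
    (hQ20 : ∀ y ∈ Icc c d, Q.b20 y = (Z y)ᵀ * Hy0)
    (hQxx1 : ∀ x ∈ Icc a b, ∀ θ ∈ Icc a b, Q.b11.k1 x θ = (Z x)ᵀ * Gxx * Z θ)
    (hQ12 : ∀ x ∈ Icc a b, ∀ y ∈ Icc c d, Q.b12 x y = (Z x)ᵀ * Gxy * Z y)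
    (hQ21 : ∀ y ∈ Icc c d, ∀ x ∈ Icc a b, Q.b21 y x = (Z y)ᵀ * Gyx * Z x)
    (hQyy1 : ∀ y ∈ Icc c d, ∀ ν ∈ Icc c d, Q.b22.k1 y ν = (Z y)ᵀ * Gyy * Z ν)
    -- invertibility of the multiplier parameters
    (hQ00 : IsUnit Q.b00)
    (hQxx0 : ∀ x ∈ Icc a b, IsUnit (Q.b11.k0 x))
    (hQyy0 : ∀ y ∈ Icc c d, IsUnit (Q.b22.k0 y))
    -- the derived matrices
    (Kxx Kyy : Matrix (Fin q) (Fin q) ℝ)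
    (hKxx : Kxx = mInt a b fun x => Z x * (Q.b11.k0 x)⁻¹ * (Z x)ᵀ)
    (hKyy : Kyy = mInt c d fun y => Z y * (Q.b22.k0 y)⁻¹ * (Z y)ᵀ)
    (Pxx Pxy Pyx Pyy : Matrix (Fin q) (Fin q) ℝ)
    (hPxx : Pxx = Gxx - Hx0 * Q.b00⁻¹ * H0x)
    (hPxy : Pxy = Gxy - Hx0 * Q.b00⁻¹ * H0y)
    (hPyx : Pyx = Gyx - Hy0 * Q.b00⁻¹ * H0x)
    (hPyy : Pyy = Gyy - Hy0 * Q.b00⁻¹ * H0y)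
    -- invertibility of the derived matrices
    (hSx : IsUnit (1 + Kxx * Pxx))
    (hSy : IsUnit (1 + Kyy * Pyy))
    (hSxy : IsUnit (1 + Kxx * Pxx - Kxx * Pxy * (1 + Kyy * Pyy)⁻¹ * Kyy * Pyx))
    (hSyx : IsUnit (1 + Kyy * Pyy - Kyy * Pyx * (1 + Kxx * Pxx)⁻¹ * Kxx * Pxy)) :
    ∃ Qh : PI011K n0 n1 n0 n1, Qh.IsCont a b c d ∧
      ∀ (v : Fin n0 → ℝ) (u1 u2 : ℝ → Fin n1 → ℝ),
        ContinuousOn u1 (Icc a b) → ContinuousOn u2 (Icc c d) →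
        ((PI011 a b c d Qh (PI011 a b c d Q v u1 u2).1
            (PI011 a b c d Q v u1 u2).2.1 (PI011 a b c d Q v u1 u2).2.2).1 = v ∧
         (∀ x ∈ Icc a b,
           (PI011 a b c d Qh (PI011 a b c d Q v u1 u2).1
             (PI011 a b c d Q v u1 u2).2.1 (PI011 a b c d Q v u1 u2).2.2).2.1 x = u1 x) ∧
         (∀ y ∈ Icc c d,
           (PI011 a b c d Qh (PI011 a b c d Q v u1 u2).1
             (PI011 a b c d Q v u1 u2).2.1 (PI011 a b c d Q v u1 u2).2.2).2.2 y = u2 y))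
        ∧
        ((PI011 a b c d Q (PI011 a b c d Qh v u1 u2).1
            (PI011 a b c d Qh v u1 u2).2.1 (PI011 a b c d Qh v u1 u2).2.2).1 = v ∧
         (∀ x ∈ Icc a b,
           (PI011 a b c d Q (PI011 a b c d Qh v u1 u2).1
             (PI011 a b c d Qh v u1 u2).2.1 (PI011 a b c d Qh v u1 u2).2.2).2.1 x = u1 x) ∧
         (∀ y ∈ Icc c d,
           (PI011 a b c d Q (PI011 a b c d Qh v u1 u2).1
             (PI011 a b c d Qh v u1 u2).2.1 (PI011 a b c d Qh v u1 u2).2.2).2.2 y = u2 y)) := by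
  have hDxc := hQc.2.2.2.2.2.2.1.1
  have hDyc := hQc.2.2.2.2.2.2.2.1
  have hZt : Continuous fun x => (Z x)ᵀ := hZ.matrix_transpose
  set S := SeparableData.ofFactor Q Z H0x H0y Hx0 Hy0 Gxx Gxy Gyx Gyy with hSdef
  set K : Matrix (Fin q ⊕ Fin q) (Fin q ⊕ Fin q) ℝ := fromBlocks Kxx 0 0 Kyy with hKdef
  have hS : S.IsCont a b c d := by
    refine ⟨hDxc, Continuous.continuousOn ?_, Continuous.continuousOn ?_, hDyc,
      Continuous.continuousOn ?_, Continuous.continuousOn ?_⟩ <;>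
    refine continuous_matrix fun i j => ?_
    · rcases j with j | j
      exacts [hZt.matrix_elem i j, continuous_const]
    · rcases i with i | i
      exacts [hZ.matrix_elem i j, continuous_const]
    · rcases j with j | j
      exacts [continuous_const, hZt.matrix_elem i j]
    · rcases i with i | i
      exacts [continuous_const, hZ.matrix_elem i j]
  have hrep : S.Represents a b c d Q := by
    constructor
    · rfl
    · intro x hx; simp [hSdef, SeparableData.ofFactor, hQ01 x hx, fromCols_mul_fromRows]
    · intro y hy; simp [hSdef, SeparableData.ofFactor, hQ02 y hy, fromCols_mul_fromRows]
    · intro x hx; simp [hSdef, SeparableData.ofFactor, hQ10 x hx, fromCols_mul_fromRows]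
    · intro y hy; simp [hSdef, SeparableData.ofFactor, hQ20 y hy, fromCols_mul_fromRows]
    · intro x hx y hy
      simp [hSdef, SeparableData.ofFactor, hQ12 x hx y hy, fromCols_mul_fromBlocks,
        fromCols_mul_fromRows]
    · intro y hy x hx
      simp [hSdef, SeparableData.ofFactor, hQ21 y hy x hx, fromCols_mul_fromBlocks,
        fromCols_mul_fromRows]
    · intros; rfl
    · intro x hx θ hθ
      simp [hSdef, SeparableData.ofFactor, hQxx1 x hx θ hθ, fromCols_mul_fromBlocks,
        fromCols_mul_fromRows]
    · intro x hx θ hθ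
      simp [hSdef, SeparableData.ofFactor, hsymx, hQxx1 x hx θ hθ, fromCols_mul_fromBlocks,
        fromCols_mul_fromRows]
    · intros; rfl
    · intro y hy ν hν
      simp [hSdef, SeparableData.ofFactor, hQyy1 y hy ν hν, fromCols_mul_fromBlocks,
        fromCols_mul_fromRows]
    · intro y hy ν hν
      simp [hSdef, SeparableData.ofFactor, hsymy, hQyy1 y hy ν hν, fromCols_mul_fromBlocks,
        fromCols_mul_fromRows]
  have hgram : ∀ ξ : Fin q ⊕ Fin q → ℝ,
      (∫ x in a..b, (S.R1 x * (S.D1 x)⁻¹ * S.L1 x) *ᵥ ξ) +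
        (∫ y in c..d, (S.R2 y * (S.D2 y)⁻¹ * S.L2 y) *ᵥ ξ) = K *ᵥ ξ := by
    intro ξ
    rw [intervalIntegral_mulVec_const hab.le ((hS.R1.matrix_mul'
        (hS.D1.matrix_nonsing_inv hQxx0)).matrix_mul' hS.L1),
      intervalIntegral_mulVec_const hcd.le ((hS.R2.matrix_mul'
        (hS.D2.matrix_nonsing_inv hQyy0)).matrix_mul' hS.L2), ← Matrix.add_mulVec]
    congr 1
    ext i j
    rcases i with i | i <;> rcases j with j | j <;>
      simp [hSdef, SeparableData.ofFactor, hKdef, hKxx, hKyy, mInt, fromRows_mul, mul_fromCols]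
  have hW : IsUnit (1 + K * (S.G - S.H1 * S.M⁻¹ * S.H0)) := by
    have hblock : 1 + K * (S.G - S.H1 * S.M⁻¹ * S.H0) =
        fromBlocks (1 + Kxx * Pxx) (Kxx * Pxy) (Kyy * Pyx) (1 + Kyy * Pyy) := by
      simp [hSdef, SeparableData.ofFactor, hKdef, hPxx, hPxy, hPyx, hPyy, fromRows_mul,
        fromBlocks_multiply, fromBlocks_neg, ← fromBlocks_one, fromBlocks_add, sub_eq_add_neg]
    let _ := hSx.invertible
    rw [hblock, isUnit_fromBlocks_iff_of_invertible₁₁, invOf_eq_nonsing_inv]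
    simpa only [Matrix.mul_assoc] using hSyx
  have hT : (S.inverse K).IsCont a b c d := hS.inverse hQxx0 hQyy0
  refine ⟨(S.inverse K).kernels, hT.kernels, fun v u1 u2 hu1 hu2 => ⟨?_, ?_⟩⟩
  · exact (SeparableData.inverse_isLeftInverse hQ00 hQxx0 hQyy0 hW hgram).apply_apply
      (S.inverse K).represents_kernels hrep hT hS hab.le hcd.le v hu1 hu2
  · exact (SeparableData.isLeftInverse_inverse hQ00 hQxx0 hQyy0 hW hgram).apply_apply
      hrep (S.inverse K).represents_kernels hS hT hab.le hcd.le v hu1 hu2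
end
end

section
/- For any family B of 011-PI kernels of size (n0,n1)×(p0,p1) and any family D of (2D→011)-PI kernels of size (p0,p1)×m2, there exists a family S of (2D→011)-PI kernels of size (n0,n1)×m2 such that for every continuous u : [a,b]×[c,d] → ℝ^{m2}, P[B](P[D]u) = P[S]u (an equality of triples, holding pointwise in each component). -/
open Matrix MeasureTheory Set

noncomputable section

/-- A function of two variables, continuous on a rectangle, agrees there with a continuous one. -/
theorem exists_continuous_eq_on_Icc₂ {E : Type*} [TopologicalSpace E] {s t s' t' : ℝ}
    (h : s ≤ t) (h' : s' ≤ t') {f : ℝ → ℝ → E}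
    (hf : ContinuousOn (fun q : ℝ × ℝ => f q.1 q.2) (Icc s t ×ˢ Icc s' t')) :
    ∃ g : ℝ → ℝ → E, Continuous (fun q : ℝ × ℝ => g q.1 q.2) ∧
      ∀ x ∈ Icc s t, ∀ y ∈ Icc s' t', f x y = g x y := by
  refine ⟨fun x y => f (projIcc s t h x) (projIcc s' t' h' y), ?_, fun x hx y hy => ?_⟩
  · exact hf.comp_continuous
      (f := fun q : ℝ × ℝ => ((projIcc s t h q.1 : ℝ), (projIcc s' t' h' q.2 : ℝ)))
      (by fun_prop) fun q => ⟨Subtype.prop _, Subtype.prop _⟩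
  · simp only [projIcc_of_mem h hx, projIcc_of_mem h' hy]

/-- A function of one variable, continuous on an interval, agrees there with a continuous one. -/
theorem exists_continuous_eq_on_Icc {E : Type*} [TopologicalSpace E] {s t : ℝ}
    (h : s ≤ t) {f : ℝ → E} (hf : ContinuousOn f (Icc s t)) :
    ∃ g : ℝ → E, Continuous g ∧ ∀ x ∈ Icc s t, f x = g x := by
  refine ⟨fun x => f (projIcc s t h x), ?_, fun x hx => ?_⟩
  · exact hf.comp_continuous (by fun_prop) fun q => Subtype.prop _
  · simp only [projIcc_of_mem h hx]

/-- A function of three variables, continuous on a box, agrees there with a continuous one. -/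
theorem exists_continuous_eq_on_Icc₃ {E : Type*} [TopologicalSpace E] {s t s' t' s'' t'' : ℝ}
    (h : s ≤ t) (h' : s' ≤ t') (h'' : s'' ≤ t'') {f : ℝ → ℝ → ℝ → E}
    (hf : ContinuousOn (fun q : ℝ × ℝ × ℝ => f q.1 q.2.1 q.2.2)
      (Icc s t ×ˢ Icc s' t' ×ˢ Icc s'' t'')) :
    ∃ g : ℝ → ℝ → ℝ → E, Continuous (fun q : ℝ × ℝ × ℝ => g q.1 q.2.1 q.2.2) ∧
      ∀ x ∈ Icc s t, ∀ y ∈ Icc s' t', ∀ z ∈ Icc s'' t'', f x y z = g x y z := by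
  refine ⟨fun x y z => f (projIcc s t h x) (projIcc s' t' h' y) (projIcc s'' t'' h'' z), ?_,
    fun x hx y hy z hz => ?_⟩
  · exact hf.comp_continuous
      (f := fun q : ℝ × ℝ × ℝ => ((projIcc s t h q.1 : ℝ), (projIcc s' t' h' q.2.1 : ℝ),
        (projIcc s'' t'' h'' q.2.2 : ℝ)))
      (by fun_prop) fun q => ⟨Subtype.prop _, Subtype.prop _, Subtype.prop _⟩
  · simp only [projIcc_of_mem h hx, projIcc_of_mem h' hy, projIcc_of_mem h'' hz]

theorem integrable_ite {α E : Type*} [MeasurableSpace α] [NormedAddCommGroup E]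
    {μ : Measure α} {P : α → Prop} [DecidablePred P] (hP : MeasurableSet {x | P x})
    {f g : α → E} (hf : Integrable f μ) (hg : Integrable g μ) :
    Integrable (fun x => if P x then f x else g x) μ :=
  Integrable.piecewise (s := {x | P x}) hP hf.integrableOn hg.integrableOn

theorem intervalIntegrable_ite {E : Type*} [NormedAddCommGroup E]
    {P : ℝ → Prop} [DecidablePred P] (hP : MeasurableSet {x | P x}) {s t : ℝ}
    {f g : ℝ → E} (hf : IntervalIntegrable f volume s t) (hg : IntervalIntegrable g volume s t) :
    IntervalIntegrable (fun x => if P x then f x else g x) volume s t :=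
  ⟨integrable_ite hP hf.1 hg.1, integrable_ite hP hf.2 hg.2⟩

theorem intervalIntegral_ite_le {E : Type*} [NormedAddCommGroup E] [NormedSpace ℝ E]
    {f g : ℝ → E} (hf : Continuous f) (hg : Continuous g) {s t x : ℝ} (hx : x ∈ Icc s t) :
    (∫ σ in s..t, if σ ≤ x then f σ else g σ) = (∫ σ in s..x, f σ) + ∫ σ in x..t, g σ := by
  have hi (s t : ℝ) : IntervalIntegrable (fun σ => if σ ≤ x then f σ else g σ) volume s t :=
    intervalIntegrable_ite measurableSet_Iic (hf.intervalIntegrable _ _)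
      (hg.intervalIntegrable _ _)
  rw [← intervalIntegral.integral_add_adjacent_intervals (hi s x) (hi x t)]
  congr 1 <;> refine intervalIntegral.integral_congr_ae (.of_forall fun σ hσ => ?_)
  · rw [uIoc_of_le hx.1] at hσ
    exact if_pos hσ.2
  · rw [uIoc_of_le hx.2] at hσ
    exact if_neg hσ.1.not_ge

theorem mulVec_intervalIntegral {p r : ℕ} (M : Matrix (Fin p) (Fin r) ℝ) {f : ℝ → Fin r → ℝ}
    {s t : ℝ} (hf : IntervalIntegrable f volume s t) :
    M *ᵥ (∫ σ in s..t, f σ) = ∫ σ in s..t, M *ᵥ f σ :=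
  ((LinearMap.toContinuousLinearMap M.mulVecLin).intervalIntegral_comp_comm hf).symm

theorem intervalIntegral_apply {r : ℕ} {f : ℝ → Fin r → ℝ} {s t : ℝ}
    (hf : IntervalIntegrable f volume s t) (i : Fin r) :
    (∫ σ in s..t, f σ) i = ∫ σ in s..t, f σ i :=
  ((ContinuousLinearMap.proj (R := ℝ) (φ := fun _ : Fin r => ℝ) i).intervalIntegral_comp_comm
    hf).symm

theorem mInt_mulVec {p r : ℕ} {F : ℝ → Matrix (Fin p) (Fin r) ℝ} {s t : ℝ}
    (hF : ∀ i j, IntervalIntegrable (fun σ => F σ i j) volume s t) (v : Fin r → ℝ) :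
    mInt s t F *ᵥ v = ∫ σ in s..t, F σ *ᵥ v := by
  have h (i : Fin p) (j : Fin r) : IntervalIntegrable (fun σ => F σ i j * v j) volume s t :=
    (hF i j).mul_const _
  have hv : IntervalIntegrable (fun σ => F σ *ᵥ v) volume s t := by
    have h' (i : Fin p) : IntervalIntegrable (fun σ => (F σ *ᵥ v) i) volume s t := by
      simpa [mulVec, dotProduct, Finset.sum_fn] using
        IntervalIntegrable.sum Finset.univ fun j _ => h i j
    exact ⟨Integrable.of_eval fun i => (h' i).1, Integrable.of_eval fun i => (h' i).2⟩
  ext i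
  rw [intervalIntegral_apply hv]
  simp only [mulVec, dotProduct, mInt, of_apply]
  rw [intervalIntegral.integral_finsetSum fun j _ => h i j]
  simp only [intervalIntegral.integral_mul_const]

/-- Fubini for continuous functions on a rectangle. -/
theorem intervalIntegral_swap_of_continuous {E : Type*} [NormedAddCommGroup E] [NormedSpace ℝ E]
    [CompleteSpace E] {f : ℝ → ℝ → E} (hf : Continuous (fun q : ℝ × ℝ => f q.1 q.2))
    (a b c d : ℝ) :
    (∫ x in a..b, ∫ y in c..d, f x y) = ∫ y in c..d, ∫ x in a..b, f x y := by
  refine intervalIntegral_intervalIntegral_swap ?_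
  exact (hf.continuousOn.integrableOn_compact (isCompact_uIcc.prod isCompact_uIcc)).mono_set
    (prod_mono uIoc_subset_uIcc uIoc_subset_uIcc)

/-- An integral of a function with jumps along two graphs depends continuously on parameters. -/
theorem continuous_intervalIntegral_ite {X E : Type*} [TopologicalSpace X]
    [FirstCountableTopology X] [LocallyCompactSpace X] [NormedAddCommGroup E] [NormedSpace ℝ E]
    {f₁ f₂ f₃ f₄ : X → ℝ → E}
    (h₁ : Continuous fun q : X × ℝ => f₁ q.1 q.2) (h₂ : Continuous fun q : X × ℝ => f₂ q.1 q.2)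
    (h₃ : Continuous fun q : X × ℝ => f₃ q.1 q.2) (h₄ : Continuous fun q : X × ℝ => f₄ q.1 q.2)
    {s t : X → ℝ} (hs : Continuous s) (ht : Continuous t) (a b : ℝ) :
    Continuous fun p => ∫ σ in a..b,
      if σ ≤ s p then (if t p ≤ σ then f₁ p σ else f₂ p σ)
      else (if t p ≤ σ then f₃ p σ else f₄ p σ) := by
  rw [continuous_iff_continuousAt]
  intro p₀
  obtain ⟨K, hK, hK₀⟩ := exists_compact_mem_nhds p₀
  have hH : Continuous fun q : X × ℝ =>
      ‖f₁ q.1 q.2‖ + ‖f₂ q.1 q.2‖ + ‖f₃ q.1 q.2‖ + ‖f₄ q.1 q.2‖ := by fun_prop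
  obtain ⟨M, hM⟩ := (hK.prod (isCompact_uIcc (a := a) (b := b))).bddAbove_image hH.continuousOn
  refine intervalIntegral.continuousAt_of_dominated_interval (bound := fun _ => M)
    (.of_forall fun p => ?_) ?_ intervalIntegrable_const ?_
  · have m {f : X → ℝ → E} (hf : Continuous fun q : X × ℝ => f q.1 q.2) :
        IntervalIntegrable (f p) volume a b :=
      (hf.comp (by fun_prop : Continuous fun σ : ℝ => (p, σ))).intervalIntegrable a b
    exact (intervalIntegrable_ite measurableSet_Iic
      (intervalIntegrable_ite measurableSet_Ici (m h₁) (m h₂))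
      (intervalIntegrable_ite measurableSet_Ici (m h₃) (m h₄))).def'.aestronglyMeasurable
  · filter_upwards [hK₀] with p hp
    refine .of_forall fun σ hσ => ?_
    have := hM (mem_image_of_mem _ (show (p, σ) ∈ K ×ˢ uIcc a b from ⟨hp, uIoc_subset_uIcc hσ⟩))
    simp only at this
    have n₁ := norm_nonneg (f₁ p σ)
    have n₂ := norm_nonneg (f₂ p σ)
    have n₃ := norm_nonneg (f₃ p σ)
    have n₄ := norm_nonneg (f₄ p σ)
    split_ifs <;> linarith
  · have hne : ∀ᵐ σ : ℝ, σ ≠ s p₀ ∧ σ ≠ t p₀ :=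
      (Measure.ae_ne volume _).and (Measure.ae_ne volume _)
    filter_upwards [hne] with σ hσ _
    have m {f : X → ℝ → E} (hf : Continuous fun q : X × ℝ => f q.1 q.2) :
        ContinuousAt (fun p => f p σ) p₀ :=
      (hf.comp (by fun_prop : Continuous fun p : X => (p, σ))).continuousAt
    have key {f g : X → E} (hf : ContinuousAt f p₀) (hg : ContinuousAt g p₀) :
        ContinuousAt (fun p => if t p ≤ σ then f p else g p) p₀ := by
      rcases lt_or_gt_of_ne hσ.2 with h | h
      · refine hg.congr ?_
        filter_upwards [ht.continuousAt.eventually_const_lt h] with p hp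
        rw [if_neg hp.not_ge]
      · refine hf.congr ?_
        filter_upwards [ht.continuousAt.eventually_lt_const h] with p hp
        rw [if_pos hp.le]
    rcases lt_or_gt_of_ne hσ.1 with h | h
    · refine (key (m h₁) (m h₂)).congr ?_
      filter_upwards [hs.continuousAt.eventually_const_lt h] with p hp
      rw [if_pos hp.le]
    · refine (key (m h₃) (m h₄)).congr ?_
      filter_upwards [hs.continuousAt.eventually_lt_const h] with p hp
      rw [if_neg hp.not_ge]

/-- The smooth part of the kernel of a composition of two integral operators on `[a,b]`, the first
with kernel `A₁` below and `A₂` above the diagonal (at a fixed row `x`), the second likewise with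
`K₁` and `K₂`. -/
def compKernel {n p r : ℕ} (a b : ℝ) (A₁ A₂ : ℝ → Matrix (Fin n) (Fin p) ℝ)
    (K₁ K₂ : ℝ → ℝ → Matrix (Fin p) (Fin r) ℝ) (x θ : ℝ) : Matrix (Fin n) (Fin r) ℝ :=
  mInt a b fun σ => (if σ ≤ x then A₁ σ else A₂ σ) * (if θ ≤ σ then K₁ σ θ else K₂ σ θ)

theorem ite_mul_ite_apply {n p r : ℕ} (P Q : Prop) [Decidable P] [Decidable Q]
    (A₁ A₂ : Matrix (Fin n) (Fin p) ℝ) (K₁ K₂ : Matrix (Fin p) (Fin r) ℝ) (i : Fin n)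
    (j : Fin r) :
    ((if P then A₁ else A₂) * (if Q then K₁ else K₂)) i j =
      if P then (if Q then (A₁ * K₁) i j else (A₁ * K₂) i j)
      else (if Q then (A₂ * K₁) i j else (A₂ * K₂) i j) := by
  split_ifs <;> rfl

theorem continuous_compKernel {X : Type*} [TopologicalSpace X] [FirstCountableTopology X]
    [LocallyCompactSpace X] {n p r : ℕ} {A₁ A₂ : X → ℝ → Matrix (Fin n) (Fin p) ℝ}
    {K₁ K₂ : X → ℝ → ℝ → Matrix (Fin p) (Fin r) ℝ}
    (hA₁ : Continuous fun q : X × ℝ => A₁ q.1 q.2) (hA₂ : Continuous fun q : X × ℝ => A₂ q.1 q.2)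
    (hK₁ : Continuous fun q : X × ℝ × ℝ => K₁ q.1 q.2.1 q.2.2)
    (hK₂ : Continuous fun q : X × ℝ × ℝ => K₂ q.1 q.2.1 q.2.2)
    {s t : X → ℝ} (hs : Continuous s) (ht : Continuous t) (a b : ℝ) :
    Continuous fun q => compKernel a b (A₁ q) (A₂ q) (K₁ q) (K₂ q) (s q) (t q) := by
  refine continuous_matrix fun i j => ?_
  simp only [compKernel, mInt, of_apply, ite_mul_ite_apply]
  have m {A : X → ℝ → Matrix (Fin n) (Fin p) ℝ} {K : X → ℝ → ℝ → Matrix (Fin p) (Fin r) ℝ}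
      (hA : Continuous fun q : X × ℝ => A q.1 q.2)
      (hK : Continuous fun q : X × ℝ × ℝ => K q.1 q.2.1 q.2.2) :
      Continuous fun q : X × ℝ => (A q.1 q.2 * K q.1 q.2 (t q.1)) i j :=
    Continuous.matrix_elem (by fun_prop) i j
  exact continuous_intervalIntegral_ite (m hA₁ hK₁) (m hA₁ hK₂) (m hA₂ hK₁) (m hA₂ hK₂) hs ht a b

theorem intervalIntegral_mulVec_intervalIntegral {n p r : ℕ} {a b x : ℝ} (hx : x ∈ Icc a b)
    {A₁ A₂ : ℝ → Matrix (Fin n) (Fin p) ℝ} {K₁ K₂ : ℝ → ℝ → Matrix (Fin p) (Fin r) ℝ}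
    {v : ℝ → Fin r → ℝ} (hA₁ : Continuous A₁) (hA₂ : Continuous A₂)
    (hK₁ : Continuous fun q : ℝ × ℝ => K₁ q.1 q.2) (hK₂ : Continuous fun q : ℝ × ℝ => K₂ q.1 q.2)
    (hv : Continuous v) :
    (∫ σ in a..x, A₁ σ *ᵥ ((∫ θ in a..σ, K₁ σ θ *ᵥ v θ) + ∫ θ in σ..b, K₂ σ θ *ᵥ v θ)) +
      (∫ σ in x..b, A₂ σ *ᵥ ((∫ θ in a..σ, K₁ σ θ *ᵥ v θ) + ∫ θ in σ..b, K₂ σ θ *ᵥ v θ)) =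
      ∫ θ in a..b, compKernel a b A₁ A₂ K₁ K₂ x θ *ᵥ v θ := by
  have hab : a ≤ b := hx.1.trans hx.2
  have hh : Continuous fun σ =>
      (∫ θ in a..σ, K₁ σ θ *ᵥ v θ) + ∫ θ in σ..b, K₂ σ θ *ᵥ v θ := by
    simp_rw [intervalIntegral.integral_symm b]
    fun_prop
  rw [← intervalIntegral_ite_le (by fun_prop) (by fun_prop) hx]
  have inner : ∀ σ ∈ uIcc a b,
      (if σ ≤ x then A₁ σ *ᵥ ((∫ θ in a..σ, K₁ σ θ *ᵥ v θ) + ∫ θ in σ..b, K₂ σ θ *ᵥ v θ)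
        else A₂ σ *ᵥ ((∫ θ in a..σ, K₁ σ θ *ᵥ v θ) + ∫ θ in σ..b, K₂ σ θ *ᵥ v θ)) =
      ∫ θ in a..b, ((if σ ≤ x then A₁ σ else A₂ σ) * (if θ ≤ σ then K₁ σ θ else K₂ σ θ)) *ᵥ v θ := by
    intro σ hσ
    rw [uIcc_of_le hab] at hσ
    rw [← intervalIntegral_ite_le (by fun_prop) (by fun_prop) hσ]
    have e : (∫ θ in a..b, if θ ≤ σ then K₁ σ θ *ᵥ v θ else K₂ σ θ *ᵥ v θ) =
        ∫ θ in a..b, (if θ ≤ σ then K₁ σ θ else K₂ σ θ) *ᵥ v θ := by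
      congr with θ; split_ifs <;> rfl
    have hi : IntervalIntegrable (fun θ => (if θ ≤ σ then K₁ σ θ else K₂ σ θ) *ᵥ v θ)
        volume a b := by
      refine (intervalIntegrable_ite (P := (· ≤ σ)) measurableSet_Iic
        (f := fun θ => K₁ σ θ *ᵥ v θ) (g := fun θ => K₂ σ θ *ᵥ v θ)
        (Continuous.intervalIntegrable (by fun_prop) _ _)
        (Continuous.intervalIntegrable (by fun_prop) _ _)).congr fun θ _ => ?_
      split_ifs <;> rfl
    simp only [e, ← mulVec_mulVec]
    split_ifs <;> exact mulVec_intervalIntegral _ hi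
  rw [intervalIntegral.integral_congr inner, intervalIntegral_intervalIntegral_swap]
  · refine intervalIntegral.integral_congr fun θ _ => (mInt_mulVec (fun i j => ?_) (v θ)).symm
    simp only [ite_mul_ite_apply]
    have m {A : ℝ → Matrix (Fin n) (Fin p) ℝ} {K : ℝ → ℝ → Matrix (Fin p) (Fin r) ℝ}
        (hA : Continuous A) (hK : Continuous fun q : ℝ × ℝ => K q.1 q.2) :
        IntervalIntegrable (fun σ => (A σ * K σ θ) i j) volume a b :=
      (Continuous.matrix_elem (by fun_prop) i j).intervalIntegrable a b
    exact intervalIntegrable_ite measurableSet_Iic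
      (intervalIntegrable_ite measurableSet_Ici (m hA₁ hK₁) (m hA₁ hK₂))
      (intervalIntegrable_ite measurableSet_Ici (m hA₂ hK₁) (m hA₂ hK₂))
  · have m {A : ℝ → Matrix (Fin n) (Fin p) ℝ} {K : ℝ → ℝ → Matrix (Fin p) (Fin r) ℝ}
        (hA : Continuous A) (hK : Continuous fun q : ℝ × ℝ => K q.1 q.2) :
        IntegrableOn (fun q : ℝ × ℝ => (A q.1 * K q.1 q.2) *ᵥ v q.2) (uIoc a b ×ˢ uIoc a b) :=
      (Continuous.continuousOn (by fun_prop)).integrableOn_compact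
        (isCompact_uIcc.prod isCompact_uIcc) |>.mono_set
          (prod_mono uIoc_subset_uIcc uIoc_subset_uIcc)
    have h₁ : MeasurableSet {q : ℝ × ℝ | q.1 ≤ x} := measurableSet_le (by fun_prop) (by fun_prop)
    have h₂ : MeasurableSet {q : ℝ × ℝ | q.2 ≤ q.1} :=
      measurableSet_le (by fun_prop) (by fun_prop)
    refine Integrable.congr (integrable_ite h₁ (integrable_ite h₂ (m hA₁ hK₁) (m hA₁ hK₂))
      (integrable_ite h₂ (m hA₂ hK₁) (m hA₂ hK₂))) (.of_forall fun q => ?_)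
    simp only [Function.uncurry]
    split_ifs <;> rfl

/-- The one-dimensional components of a (2D→011)-PI operator. -/
def stripOp {p r : ℕ} (a b c d : ℝ) (K₀ : ℝ → ℝ → Matrix (Fin p) (Fin r) ℝ)
    (K₁ K₂ : ℝ → ℝ → ℝ → Matrix (Fin p) (Fin r) ℝ) (u : ℝ → ℝ → Fin r → ℝ) (x : ℝ) :
    Fin p → ℝ :=
  ∫ y in c..d, (K₀ x y *ᵥ u x y + (∫ θ in a..x, K₁ x y θ *ᵥ u θ y) +
    (∫ θ in x..b, K₂ x y θ *ᵥ u θ y))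

section

variable {n p q r : ℕ} {a b c d x : ℝ}
  {K₀ : ℝ → ℝ → Matrix (Fin p) (Fin r) ℝ} {K₁ K₂ : ℝ → ℝ → ℝ → Matrix (Fin p) (Fin r) ℝ}
  {u : ℝ → ℝ → Fin r → ℝ}

/-- The kernel of the functional obtained by integrating a one-dimensional component of a
(2D→011)-PI operator against `A₁` on `[a,x]` and `A₂` on `[x,b]`; the weight `A` is the one of `A₁`,
`A₂` that is active at `θ`. -/
def stripKernel (a b : ℝ) (A A₁ A₂ : ℝ → Matrix (Fin n) (Fin p) ℝ)
    (K₀ : ℝ → ℝ → Matrix (Fin p) (Fin r) ℝ) (K₁ K₂ : ℝ → ℝ → ℝ → Matrix (Fin p) (Fin r) ℝ)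
    (x y θ : ℝ) : Matrix (Fin n) (Fin r) ℝ :=
  A θ * K₀ θ y + compKernel a b A₁ A₂ (fun σ τ => K₁ σ y τ) (fun σ τ => K₂ σ y τ) x θ

theorem continuous_stripKernel {X : Type*} [TopologicalSpace X] [FirstCountableTopology X]
    [LocallyCompactSpace X] {A A₁ A₂ : X → ℝ → Matrix (Fin n) (Fin p) ℝ}
    (hA : Continuous fun q : X × ℝ => A q.1 q.2)
    (hA₁ : Continuous fun q : X × ℝ => A₁ q.1 q.2)
    (hA₂ : Continuous fun q : X × ℝ => A₂ q.1 q.2)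
    (hK₀ : Continuous fun q : ℝ × ℝ => K₀ q.1 q.2)
    (hK₁ : Continuous fun q : ℝ × ℝ × ℝ => K₁ q.1 q.2.1 q.2.2)
    (hK₂ : Continuous fun q : ℝ × ℝ × ℝ => K₂ q.1 q.2.1 q.2.2)
    {f g h : X → ℝ} (hf : Continuous f) (hg : Continuous g) (hh : Continuous h) (a b : ℝ) :
    Continuous fun q => stripKernel a b (A q) (A₁ q) (A₂ q) K₀ K₁ K₂ (f q) (g q) (h q) :=
  Continuous.add (by fun_prop) (continuous_compKernel (K₁ := fun q σ τ => K₁ σ (g q) τ)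
    (K₂ := fun q σ τ => K₂ σ (g q) τ) hA₁ hA₂ (by fun_prop) (by fun_prop) hf hh a b)

theorem continuous_stripOp_integrand
    (hK₀ : Continuous fun q : ℝ × ℝ => K₀ q.1 q.2)
    (hK₁ : Continuous fun q : ℝ × ℝ × ℝ => K₁ q.1 q.2.1 q.2.2)
    (hK₂ : Continuous fun q : ℝ × ℝ × ℝ => K₂ q.1 q.2.1 q.2.2)
    (hu : Continuous fun q : ℝ × ℝ => u q.1 q.2) (a b : ℝ) :
    Continuous fun q : ℝ × ℝ => K₀ q.1 q.2 *ᵥ u q.1 q.2 +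
      (∫ θ in a..q.1, K₁ q.1 q.2 θ *ᵥ u θ q.2) + (∫ θ in q.1..b, K₂ q.1 q.2 θ *ᵥ u θ q.2) := by
  simp_rw [intervalIntegral.integral_symm b]
  fun_prop

theorem intervalIntegral_mulVec_stripOp (hx : x ∈ Icc a b)
    {A₁ A₂ : ℝ → Matrix (Fin n) (Fin p) ℝ} (hA₁ : Continuous A₁) (hA₂ : Continuous A₂)
    (hK₀ : Continuous fun q : ℝ × ℝ => K₀ q.1 q.2)
    (hK₁ : Continuous fun q : ℝ × ℝ × ℝ => K₁ q.1 q.2.1 q.2.2)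
    (hK₂ : Continuous fun q : ℝ × ℝ × ℝ => K₂ q.1 q.2.1 q.2.2)
    (hu : Continuous fun q : ℝ × ℝ => u q.1 q.2) :
    (∫ σ in a..x, A₁ σ *ᵥ stripOp a b c d K₀ K₁ K₂ u σ) +
      (∫ σ in x..b, A₂ σ *ᵥ stripOp a b c d K₀ K₁ K₂ u σ) =
      ∫ y in c..d,
        ((∫ θ in a..x, stripKernel a b A₁ A₁ A₂ K₀ K₁ K₂ x y θ *ᵥ u θ y) +
        ∫ θ in x..b, stripKernel a b A₂ A₁ A₂ K₀ K₁ K₂ x y θ *ᵥ u θ y) := by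
  have hF := continuous_stripOp_integrand hK₀ hK₁ hK₂ hu a b
  have push (A : ℝ → Matrix (Fin n) (Fin p) ℝ) (hA : Continuous A) (s t : ℝ) :
      (∫ σ in s..t, A σ *ᵥ stripOp a b c d K₀ K₁ K₂ u σ) =
        ∫ y in c..d, ∫ σ in s..t, A σ *ᵥ (K₀ σ y *ᵥ u σ y + (∫ θ in a..σ, K₁ σ y θ *ᵥ u θ y) +
          (∫ θ in σ..b, K₂ σ y θ *ᵥ u θ y)) := by
    rw [← intervalIntegral_swap_of_continuous
      (Continuous.matrix_mulVec (hA.comp continuous_fst) hF)]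
    refine intervalIntegral.integral_congr fun σ _ => mulVec_intervalIntegral _ ?_
    exact (hF.comp (Continuous.prodMk_right σ)).intervalIntegrable _ _
  have hAF (A : ℝ → Matrix (Fin n) (Fin p) ℝ) (hA : Continuous A) :
      Continuous fun q : ℝ × ℝ => A q.2 *ᵥ (K₀ q.2 q.1 *ᵥ u q.2 q.1 +
        (∫ θ in a..q.2, K₁ q.2 q.1 θ *ᵥ u θ q.1) + (∫ θ in q.2..b, K₂ q.2 q.1 θ *ᵥ u θ q.1)) :=
    Continuous.matrix_mulVec (hA.comp continuous_snd) (hF.comp continuous_swap)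
  rw [push A₁ hA₁, push A₂ hA₂, ← intervalIntegral.integral_add]
  rotate_left
  · exact (intervalIntegral.continuous_parametric_intervalIntegral_of_continuous'
      (hAF A₁ hA₁) _ _).intervalIntegrable _ _
  · exact (intervalIntegral.continuous_parametric_intervalIntegral_of_continuous'
      (hAF A₂ hA₂) _ _).intervalIntegrable _ _
  refine intervalIntegral.integral_congr fun y _ => ?_
  have hG : Continuous fun σ =>
      (∫ θ in a..σ, K₁ σ y θ *ᵥ u θ y) + ∫ θ in σ..b, K₂ σ y θ *ᵥ u θ y := by
    simp_rw [intervalIntegral.integral_symm b]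
    fun_prop
  have hC : Continuous fun θ => compKernel a b A₁ A₂ (fun σ τ => K₁ σ y τ)
      (fun σ τ => K₂ σ y τ) x θ :=
    continuous_compKernel (A₁ := fun _ => A₁) (A₂ := fun _ => A₂) (s := fun _ => x)
      (t := fun θ => θ) (K₁ := fun _ σ τ => K₁ σ y τ) (K₂ := fun _ σ τ => K₂ σ y τ)
      (by fun_prop) (by fun_prop) (by fun_prop) (by fun_prop) (by fun_prop) (by fun_prop) a b
  have key := intervalIntegral_mulVec_intervalIntegral hx hA₁ hA₂
    (K₁ := fun σ τ => K₁ σ y τ) (K₂ := fun σ τ => K₂ σ y τ) (v := fun θ => u θ y)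
    (by fun_prop) (by fun_prop) (by fun_prop)
  rw [← (intervalIntegral.integral_add_adjacent_intervals (a := a) (b := x) (c := b)
    (Continuous.intervalIntegrable (hC.matrix_mulVec (by fun_prop)) _ _)
    (Continuous.intervalIntegrable (hC.matrix_mulVec (by fun_prop)) _ _) :
      _ = ∫ θ in a..b, compKernel a b A₁ A₂ (fun σ τ => K₁ σ y τ) (fun σ τ => K₂ σ y τ) x θ *ᵥ
        u θ y)] at key
  have split_left (A : ℝ → Matrix (Fin n) (Fin p) ℝ) (hA : Continuous A) (s t : ℝ) :
      (∫ σ in s..t, A σ *ᵥ (K₀ σ y *ᵥ u σ y + (∫ θ in a..σ, K₁ σ y θ *ᵥ u θ y) +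
        (∫ θ in σ..b, K₂ σ y θ *ᵥ u θ y))) =
        (∫ σ in s..t, A σ *ᵥ K₀ σ y *ᵥ u σ y) + ∫ σ in s..t,
          A σ *ᵥ ((∫ θ in a..σ, K₁ σ y θ *ᵥ u θ y) + ∫ θ in σ..b, K₂ σ y θ *ᵥ u θ y) := by
    simp only [add_assoc, mulVec_add _ (K₀ _ _ *ᵥ _)]
    exact intervalIntegral.integral_add (Continuous.intervalIntegrable (by fun_prop) _ _)
      ((hA.matrix_mulVec hG).intervalIntegrable _ _)
  have split_right (A : ℝ → Matrix (Fin n) (Fin p) ℝ) (hA : Continuous A) (s t : ℝ) :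
      (∫ θ in s..t, stripKernel a b A A₁ A₂ K₀ K₁ K₂ x y θ *ᵥ u θ y) =
        (∫ θ in s..t, A θ *ᵥ K₀ θ y *ᵥ u θ y) + ∫ θ in s..t,
          compKernel a b A₁ A₂ (fun σ τ => K₁ σ y τ) (fun σ τ => K₂ σ y τ) x θ *ᵥ u θ y := by
    simp only [stripKernel, add_mulVec, mulVec_mulVec]
    exact intervalIntegral.integral_add (Continuous.intervalIntegrable (by fun_prop) _ _)
      (Continuous.intervalIntegrable (by fun_prop) _ _)
  rw [split_left A₁ hA₁, split_left A₂ hA₂, split_right A₁ hA₁, split_right A₂ hA₂,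
    add_add_add_comm, key, add_add_add_comm]

theorem intervalIntegral_mulVec_stripOp_self (hab : a ≤ b)
    {A : ℝ → Matrix (Fin n) (Fin p) ℝ} (hA : Continuous A)
    (hK₀ : Continuous fun q : ℝ × ℝ => K₀ q.1 q.2)
    (hK₁ : Continuous fun q : ℝ × ℝ × ℝ => K₁ q.1 q.2.1 q.2.2)
    (hK₂ : Continuous fun q : ℝ × ℝ × ℝ => K₂ q.1 q.2.1 q.2.2)
    (hu : Continuous fun q : ℝ × ℝ => u q.1 q.2) :
    (∫ σ in a..b, A σ *ᵥ stripOp a b c d K₀ K₁ K₂ u σ) =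
      ∫ y in c..d, ∫ θ in a..b, stripKernel a b A A A K₀ K₁ K₂ b y θ *ᵥ u θ y := by
  simpa using intervalIntegral_mulVec_stripOp (c := c) (d := d) (right_mem_Icc.2 hab) hA hA
    hK₀ hK₁ hK₂ hu

theorem stripOp_congr (hcd : c ≤ d) (hx : x ∈ Icc a b)
    {K₀' : ℝ → ℝ → Matrix (Fin p) (Fin r) ℝ} {K₁' K₂' : ℝ → ℝ → ℝ → Matrix (Fin p) (Fin r) ℝ}
    {u' : ℝ → ℝ → Fin r → ℝ}
    (h₀ : ∀ x ∈ Icc a b, ∀ y ∈ Icc c d, K₀ x y = K₀' x y)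
    (h₁ : ∀ x ∈ Icc a b, ∀ y ∈ Icc c d, ∀ θ ∈ Icc a b, K₁ x y θ = K₁' x y θ)
    (h₂ : ∀ x ∈ Icc a b, ∀ y ∈ Icc c d, ∀ θ ∈ Icc a b, K₂ x y θ = K₂' x y θ)
    (hu : ∀ x ∈ Icc a b, ∀ y ∈ Icc c d, u x y = u' x y) :
    stripOp a b c d K₀ K₁ K₂ u x = stripOp a b c d K₀' K₁' K₂' u' x := by
  refine intervalIntegral.integral_congr fun y hy => ?_
  rw [uIcc_of_le hcd] at hy
  have e₁ : (∫ θ in a..x, K₁ x y θ *ᵥ u θ y) = ∫ θ in a..x, K₁' x y θ *ᵥ u' θ y := by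
    refine intervalIntegral.integral_congr fun θ hθ => ?_
    rw [uIcc_of_le hx.1] at hθ
    have hθ' : θ ∈ Icc a b := ⟨hθ.1, hθ.2.trans hx.2⟩
    simp only [h₁ x hx y hy θ hθ', hu θ hθ' y hy]
  have e₂ : (∫ θ in x..b, K₂ x y θ *ᵥ u θ y) = ∫ θ in x..b, K₂' x y θ *ᵥ u' θ y := by
    refine intervalIntegral.integral_congr fun θ hθ => ?_
    rw [uIcc_of_le hx.2] at hθ
    have hθ' : θ ∈ Icc a b := ⟨hx.1.trans hθ.1, hθ.2⟩
    simp only [h₂ x hx y hy θ hθ', hu θ hθ' y hy]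
  simp only [h₀ x hx y hy, hu x hx y hy, e₁, e₂]

theorem PI1D_congr {N N' : PI1DK n p} {v v' : ℝ → Fin p → ℝ} (hx : x ∈ Icc a b)
    (h₀ : ∀ x ∈ Icc a b, N.k0 x = N'.k0 x)
    (h₁ : ∀ x ∈ Icc a b, ∀ θ ∈ Icc a b, N.k1 x θ = N'.k1 x θ)
    (h₂ : ∀ x ∈ Icc a b, ∀ θ ∈ Icc a b, N.k2 x θ = N'.k2 x θ)
    (hv : ∀ x ∈ Icc a b, v x = v' x) :
    PI1D a b N v x = PI1D a b N' v' x := by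
  have e₁ : (∫ θ in a..x, N.k1 x θ *ᵥ v θ) = ∫ θ in a..x, N'.k1 x θ *ᵥ v' θ := by
    refine intervalIntegral.integral_congr fun θ hθ => ?_
    rw [uIcc_of_le hx.1] at hθ
    have hθ' : θ ∈ Icc a b := ⟨hθ.1, hθ.2.trans hx.2⟩
    simp only [h₁ x hx θ hθ', hv θ hθ']
  have e₂ : (∫ θ in x..b, N.k2 x θ *ᵥ v θ) = ∫ θ in x..b, N'.k2 x θ *ᵥ v' θ := by
    refine intervalIntegral.integral_congr fun θ hθ => ?_
    rw [uIcc_of_le hx.2] at hθ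
    have hθ' : θ ∈ Icc a b := ⟨hx.1.trans hθ.1, hθ.2⟩
    simp only [h₂ x hx θ hθ', hv θ hθ']
  simp only [PI1D, h₀ x hx, hv x hx, e₁, e₂]

/-- The kernel of the part of a one-dimensional component of a composition of a (2D→011)-PI operator
and a 011-PI operator which integrates along the direction of that component. -/
def lineKernel (a b c d : ℝ) (M : ℝ → Matrix (Fin n) (Fin q) ℝ) (N : PI1DK n p)
    (C : ℝ → ℝ → Matrix (Fin n) (Fin p) ℝ) (D₀ : ℝ → ℝ → Matrix (Fin q) (Fin r) ℝ)
    (K₀ : ℝ → ℝ → Matrix (Fin p) (Fin r) ℝ) (K₁ K₂ : ℝ → ℝ → ℝ → Matrix (Fin p) (Fin r) ℝ)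
    (L₀ : ℝ → ℝ → Matrix (Fin p) (Fin r) ℝ) (L₁ L₂ : ℝ → ℝ → ℝ → Matrix (Fin p) (Fin r) ℝ)
    (A : ℝ → ℝ → Matrix (Fin n) (Fin p) ℝ) (K : ℝ → ℝ → ℝ → Matrix (Fin p) (Fin r) ℝ)
    (x y θ : ℝ) : Matrix (Fin n) (Fin r) ℝ :=
  M x * D₀ θ y + N.k0 x * K x y θ + stripKernel a b (A x) (N.k1 x) (N.k2 x) K₀ K₁ K₂ x y θ +
    stripKernel c d (C x) (C x) (C x) L₀ L₁ L₂ d θ y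

variable {M : ℝ → Matrix (Fin n) (Fin q) ℝ} {N : PI1DK n p}
  {C : ℝ → ℝ → Matrix (Fin n) (Fin p) ℝ} {D₀ : ℝ → ℝ → Matrix (Fin q) (Fin r) ℝ}
  {L₀ : ℝ → ℝ → Matrix (Fin p) (Fin r) ℝ} {L₁ L₂ : ℝ → ℝ → ℝ → Matrix (Fin p) (Fin r) ℝ}

theorem continuous_lineKernel (hM : Continuous M) (hN₀ : Continuous N.k0)
    (hN₁ : Continuous fun q : ℝ × ℝ => N.k1 q.1 q.2)
    (hN₂ : Continuous fun q : ℝ × ℝ => N.k2 q.1 q.2)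
    (hC : Continuous fun q : ℝ × ℝ => C q.1 q.2) (hD₀ : Continuous fun q : ℝ × ℝ => D₀ q.1 q.2)
    (hK₀ : Continuous fun q : ℝ × ℝ => K₀ q.1 q.2)
    (hK₁ : Continuous fun q : ℝ × ℝ × ℝ => K₁ q.1 q.2.1 q.2.2)
    (hK₂ : Continuous fun q : ℝ × ℝ × ℝ => K₂ q.1 q.2.1 q.2.2)
    (hL₀ : Continuous fun q : ℝ × ℝ => L₀ q.1 q.2)
    (hL₁ : Continuous fun q : ℝ × ℝ × ℝ => L₁ q.1 q.2.1 q.2.2)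
    (hL₂ : Continuous fun q : ℝ × ℝ × ℝ => L₂ q.1 q.2.1 q.2.2)
    {A : ℝ → ℝ → Matrix (Fin n) (Fin p) ℝ} {K : ℝ → ℝ → ℝ → Matrix (Fin p) (Fin r) ℝ}
    (hA : Continuous fun q : ℝ × ℝ => A q.1 q.2)
    (hK : Continuous fun q : ℝ × ℝ × ℝ => K q.1 q.2.1 q.2.2) (a b c d : ℝ) :
    Continuous fun q : ℝ × ℝ × ℝ =>
      lineKernel a b c d M N C D₀ K₀ K₁ K₂ L₀ L₁ L₂ A K q.1 q.2.1 q.2.2 := by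
  have h {A : ℝ → ℝ → Matrix (Fin n) (Fin p) ℝ} (hA : Continuous fun q : ℝ × ℝ => A q.1 q.2) :
      Continuous fun q : (ℝ × ℝ × ℝ) × ℝ => A q.1.1 q.2 :=
    hA.comp (by fun_prop : Continuous fun q : (ℝ × ℝ × ℝ) × ℝ => (q.1.1, q.2))
  refine Continuous.add (Continuous.add (by fun_prop) ?_) ?_
  · exact continuous_stripKernel (A := fun q : ℝ × ℝ × ℝ => A q.1)
      (A₁ := fun q : ℝ × ℝ × ℝ => N.k1 q.1) (A₂ := fun q : ℝ × ℝ × ℝ => N.k2 q.1)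
      (h hA) (h hN₁) (h hN₂) hK₀ hK₁ hK₂ (by fun_prop) (by fun_prop) (by fun_prop) a b
  · exact continuous_stripKernel (A := fun q : ℝ × ℝ × ℝ => C q.1)
      (A₁ := fun q : ℝ × ℝ × ℝ => C q.1) (A₂ := fun q : ℝ × ℝ × ℝ => C q.1)
      (h hC) (h hC) (h hC) hL₀ hL₁ hL₂ (by fun_prop) (by fun_prop) (by fun_prop) c d

theorem component_comp_eq_stripOp (hx : x ∈ Icc a b) (hcd : c ≤ d)
    (hN₁ : Continuous fun q : ℝ × ℝ => N.k1 q.1 q.2)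
    (hN₂ : Continuous fun q : ℝ × ℝ => N.k2 q.1 q.2)
    (hC : Continuous fun q : ℝ × ℝ => C q.1 q.2) (hD₀ : Continuous fun q : ℝ × ℝ => D₀ q.1 q.2)
    (hK₀ : Continuous fun q : ℝ × ℝ => K₀ q.1 q.2)
    (hK₁ : Continuous fun q : ℝ × ℝ × ℝ => K₁ q.1 q.2.1 q.2.2)
    (hK₂ : Continuous fun q : ℝ × ℝ × ℝ => K₂ q.1 q.2.1 q.2.2)
    (hL₀ : Continuous fun q : ℝ × ℝ => L₀ q.1 q.2)
    (hL₁ : Continuous fun q : ℝ × ℝ × ℝ => L₁ q.1 q.2.1 q.2.2)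
    (hL₂ : Continuous fun q : ℝ × ℝ × ℝ => L₂ q.1 q.2.1 q.2.2)
    (hu : Continuous fun q : ℝ × ℝ => u q.1 q.2) :
    M x *ᵥ (∫ y in c..d, ∫ θ in a..b, D₀ θ y *ᵥ u θ y) +
        PI1D a b N (stripOp a b c d K₀ K₁ K₂ u) x +
        (∫ ν in c..d, C x ν *ᵥ stripOp c d a b L₀ L₁ L₂ (fun y x => u x y) ν) =
      stripOp a b c d (fun x y => N.k0 x * K₀ x y)
        (lineKernel a b c d M N C D₀ K₀ K₁ K₂ L₀ L₁ L₂ N.k1 K₁)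
        (lineKernel a b c d M N C D₀ K₀ K₁ K₂ L₀ L₁ L₂ N.k2 K₂) u x := by
  have hR {A : ℝ → ℝ → Matrix (Fin n) (Fin p) ℝ} (hA : Continuous fun q : ℝ × ℝ => A q.1 q.2) :
      Continuous fun q : ℝ × ℝ =>
        stripKernel a b (A x) (N.k1 x) (N.k2 x) K₀ K₁ K₂ x q.1 q.2 :=
    continuous_stripKernel (A := fun _ => A x) (A₁ := fun _ => N.k1 x) (A₂ := fun _ => N.k2 x)
      (by fun_prop) (hN₁.comp (by fun_prop : Continuous fun q : (ℝ × ℝ) × ℝ => (x, q.2)))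
      (hN₂.comp (by fun_prop : Continuous fun q : (ℝ × ℝ) × ℝ => (x, q.2))) hK₀ hK₁ hK₂
      (by fun_prop) (by fun_prop) (by fun_prop) a b
  have hT : Continuous fun q : ℝ × ℝ =>
      stripKernel c d (C x) (C x) (C x) L₀ L₁ L₂ d q.2 q.1 :=
    continuous_stripKernel (A := fun _ => C x) (A₁ := fun _ => C x) (A₂ := fun _ => C x)
      (by fun_prop) (by fun_prop) (by fun_prop) hL₀ hL₁ hL₂
      (by fun_prop) (by fun_prop) (by fun_prop) c d
  have hN₁x : Continuous (N.k1 x) := hN₁.comp (Continuous.prodMk_right x)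
  have hN₂x : Continuous (N.k2 x) := hN₂.comp (Continuous.prodMk_right x)
  have hF := (continuous_stripOp_integrand hK₀ hK₁ hK₂ hu a b).comp (Continuous.prodMk_right x)
  have hR₁ := hR hN₁
  have hR₂ := hR hN₂
  set R₁ := fun y θ => stripKernel a b (N.k1 x) (N.k1 x) (N.k2 x) K₀ K₁ K₂ x y θ
  set R₂ := fun y θ => stripKernel a b (N.k2 x) (N.k1 x) (N.k2 x) K₀ K₁ K₂ x y θ
  set T := fun y θ => stripKernel c d (C x) (C x) (C x) L₀ L₁ L₂ d θ y
  have hR₁' : Continuous fun q : ℝ × ℝ => R₁ q.1 q.2 := hR₁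
  have hR₂' : Continuous fun q : ℝ × ℝ => R₂ q.1 q.2 := hR₂
  have hT' : Continuous fun q : ℝ × ℝ => T q.1 q.2 := hT
  have e₁ : M x *ᵥ (∫ y in c..d, ∫ θ in a..b, D₀ θ y *ᵥ u θ y) =
      ∫ y in c..d, M x *ᵥ ∫ θ in a..b, D₀ θ y *ᵥ u θ y :=
    mulVec_intervalIntegral _ (Continuous.intervalIntegrable (by fun_prop) _ _)
  have e₂ : N.k0 x *ᵥ stripOp a b c d K₀ K₁ K₂ u x = ∫ y in c..d, N.k0 x *ᵥ (K₀ x y *ᵥ u x y +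
      (∫ θ in a..x, K₁ x y θ *ᵥ u θ y) + (∫ θ in x..b, K₂ x y θ *ᵥ u θ y)) :=
    mulVec_intervalIntegral _ (hF.intervalIntegrable _ _)
  have e₃ : (∫ σ in a..x, N.k1 x σ *ᵥ stripOp a b c d K₀ K₁ K₂ u σ) +
      (∫ σ in x..b, N.k2 x σ *ᵥ stripOp a b c d K₀ K₁ K₂ u σ) =
      ∫ y in c..d, ((∫ θ in a..x, R₁ y θ *ᵥ u θ y) + ∫ θ in x..b, R₂ y θ *ᵥ u θ y) :=
    intervalIntegral_mulVec_stripOp hx hN₁x hN₂x hK₀ hK₁ hK₂ hu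
  have e₄ : (∫ ν in c..d, C x ν *ᵥ stripOp c d a b L₀ L₁ L₂ (fun y x => u x y) ν) =
      ∫ y in c..d, ∫ θ in a..b, T y θ *ᵥ u θ y := by
    rw [intervalIntegral_mulVec_stripOp_self hcd (by fun_prop) hL₀ hL₁ hL₂ (by fun_prop)]
    exact intervalIntegral_swap_of_continuous (f := fun θ y => T y θ *ᵥ u θ y)
      (by fun_prop) a b c d
  have i₁ : IntervalIntegrable (fun y => M x *ᵥ ∫ θ in a..b, D₀ θ y *ᵥ u θ y) volume c d :=
    Continuous.intervalIntegrable (by fun_prop) _ _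
  have i₂ : IntervalIntegrable (fun y => N.k0 x *ᵥ (K₀ x y *ᵥ u x y +
      (∫ θ in a..x, K₁ x y θ *ᵥ u θ y) + (∫ θ in x..b, K₂ x y θ *ᵥ u θ y))) volume c d :=
    Continuous.intervalIntegrable (by fun_prop) _ _
  have i₃ : IntervalIntegrable (fun y => (∫ θ in a..x, R₁ y θ *ᵥ u θ y) +
      ∫ θ in x..b, R₂ y θ *ᵥ u θ y) volume c d :=
    Continuous.intervalIntegrable (by fun_prop) _ _
  have i₄ : IntervalIntegrable (fun y => ∫ θ in a..b, T y θ *ᵥ u θ y) volume c d :=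
    Continuous.intervalIntegrable (by fun_prop) _ _
  rw [PI1D, add_assoc (N.k0 x *ᵥ _), e₁, e₂, e₃, e₄, ← intervalIntegral.integral_add i₂ i₃,
    ← intervalIntegral.integral_add i₁ (i₂.add i₃),
    ← intervalIntegral.integral_add (i₁.add (i₂.add i₃)) i₄]
  refine intervalIntegral.integral_congr fun y _ => ?_
  have line {R : ℝ → ℝ → Matrix (Fin n) (Fin r) ℝ}
      {K : ℝ → ℝ → ℝ → Matrix (Fin p) (Fin r) ℝ} (hR : Continuous fun q : ℝ × ℝ => R q.1 q.2)
      (hK : Continuous fun q : ℝ × ℝ × ℝ => K q.1 q.2.1 q.2.2) (s t : ℝ) :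
      (∫ θ in s..t, (M x * D₀ θ y + N.k0 x * K x y θ + R y θ + T y θ) *ᵥ u θ y) =
        M x *ᵥ (∫ θ in s..t, D₀ θ y *ᵥ u θ y) + N.k0 x *ᵥ (∫ θ in s..t, K x y θ *ᵥ u θ y) +
          (∫ θ in s..t, R y θ *ᵥ u θ y) + ∫ θ in s..t, T y θ *ᵥ u θ y := by
    rw [mulVec_intervalIntegral _ (Continuous.intervalIntegrable (by fun_prop) _ _),
      mulVec_intervalIntegral _ (Continuous.intervalIntegrable (by fun_prop) _ _),
      ← intervalIntegral.integral_add, ← intervalIntegral.integral_add,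
      ← intervalIntegral.integral_add]
    · simp only [add_mulVec, mulVec_mulVec]
    all_goals exact Continuous.intervalIntegrable (by fun_prop) _ _
  have adj {f : ℝ → Fin n → ℝ} (hf : Continuous f) :
      (∫ θ in a..b, f θ) = (∫ θ in a..x, f θ) + ∫ θ in x..b, f θ :=
    (intervalIntegral.integral_add_adjacent_intervals (hf.intervalIntegrable _ _)
      (hf.intervalIntegrable _ _)).symm
  have l₁ := line hR₁' hK₁ a x
  have l₂ := line hR₂' hK₂ x b
  have m : M x *ᵥ (∫ θ in a..b, D₀ θ y *ᵥ u θ y) =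
      M x *ᵥ (∫ θ in a..x, D₀ θ y *ᵥ u θ y) + M x *ᵥ ∫ θ in x..b, D₀ θ y *ᵥ u θ y := by
    rw [← mulVec_add, intervalIntegral.integral_add_adjacent_intervals] <;>
      exact Continuous.intervalIntegrable (by fun_prop) _ _
  simp only [lineKernel]
  rw [l₁, l₂, m, adj (by fun_prop), ← mulVec_mulVec]
  simp only [mulVec_add]
  abel

end

/-- Global continuity of a family of 1D-PI kernels. -/
structure PI1DK.IsContinuous {p r : ℕ} (N : PI1DK p r) : Prop where
  k0 : Continuous N.k0
  k1 : Continuous fun q : ℝ × ℝ => N.k1 q.1 q.2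
  k2 : Continuous fun q : ℝ × ℝ => N.k2 q.1 q.2

/-- Global continuity of a family of 011-PI kernels. -/
structure PI011K.IsContinuous {p0 p1 r0 r1 : ℕ} (B : PI011K p0 p1 r0 r1) : Prop where
  b01 : Continuous B.b01
  b02 : Continuous B.b02
  b10 : Continuous B.b10
  b20 : Continuous B.b20
  b12 : Continuous fun q : ℝ × ℝ => B.b12 q.1 q.2
  b21 : Continuous fun q : ℝ × ℝ => B.b21 q.1 q.2
  b11 : B.b11.IsContinuous
  b22 : B.b22.IsContinuous

/-- Global continuity of a family of (2D→011)-PI kernels. -/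
structure PI2Dto011K.IsContinuous {p0 p1 r : ℕ} (D : PI2Dto011K p0 p1 r) : Prop where
  d0 : Continuous fun q : ℝ × ℝ => D.d0 q.1 q.2
  d10 : Continuous fun q : ℝ × ℝ => D.d10 q.1 q.2
  d11 : Continuous fun q : ℝ × ℝ × ℝ => D.d11 q.1 q.2.1 q.2.2
  d12 : Continuous fun q : ℝ × ℝ × ℝ => D.d12 q.1 q.2.1 q.2.2
  d20 : Continuous fun q : ℝ × ℝ => D.d20 q.1 q.2
  d21 : Continuous fun q : ℝ × ℝ × ℝ => D.d21 q.1 q.2.1 q.2.2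
  d22 : Continuous fun q : ℝ × ℝ × ℝ => D.d22 q.1 q.2.1 q.2.2

theorem PI2Dto011K.IsContinuous.isCont {p0 p1 r : ℕ} {D : PI2Dto011K p0 p1 r}
    (hD : D.IsContinuous) (a b c d : ℝ) : D.IsCont a b c d :=
  ⟨hD.d0.continuousOn, hD.d10.continuousOn, hD.d11.continuousOn, hD.d12.continuousOn,
    hD.d20.continuousOn, hD.d21.continuousOn, hD.d22.continuousOn⟩

/-- Equality of triples of a vector, a function on `[a,b]` and a function on `[c,d]`. -/
def TripleEqOn {p0 p1 : ℕ} (a b c d : ℝ)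
    (f g : (Fin p0 → ℝ) × (ℝ → Fin p1 → ℝ) × (ℝ → Fin p1 → ℝ)) : Prop :=
  f.1 = g.1 ∧ (∀ x ∈ Icc a b, f.2.1 x = g.2.1 x) ∧ ∀ y ∈ Icc c d, f.2.2 y = g.2.2 y

theorem TripleEqOn.trans {p0 p1 : ℕ} {a b c d : ℝ}
    {f g h : (Fin p0 → ℝ) × (ℝ → Fin p1 → ℝ) × (ℝ → Fin p1 → ℝ)}
    (hfg : TripleEqOn a b c d f g) (hgh : TripleEqOn a b c d g h) : TripleEqOn a b c d f h :=
  ⟨hfg.1.trans hgh.1, fun x hx => (hfg.2.1 x hx).trans (hgh.2.1 x hx),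
    fun y hy => (hfg.2.2 y hy).trans (hgh.2.2 y hy)⟩

theorem PI1DK.IsCont.exists_isContinuous {p r : ℕ} {a b : ℝ} (hab : a ≤ b) {N : PI1DK p r}
    (hN : N.IsCont a b) :
    ∃ N' : PI1DK p r, N'.IsContinuous ∧ ∀ v v' : ℝ → Fin r → ℝ, (∀ x ∈ Icc a b, v x = v' x) →
      ∀ x ∈ Icc a b, PI1D a b N v x = PI1D a b N' v' x := by
  obtain ⟨h₀, h₁, h₂⟩ := hN
  obtain ⟨k₀, hk₀, e₀⟩ := exists_continuous_eq_on_Icc hab h₀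
  obtain ⟨k₁, hk₁, e₁⟩ := exists_continuous_eq_on_Icc₂ hab hab h₁
  obtain ⟨k₂, hk₂, e₂⟩ := exists_continuous_eq_on_Icc₂ hab hab h₂
  exact ⟨⟨k₀, k₁, k₂⟩, ⟨hk₀, hk₁, hk₂⟩, fun v v' hv x hx => PI1D_congr hx e₀ e₁ e₂ hv⟩

theorem intervalIntegral_mulVec_congr {p r : ℕ} {a b : ℝ} (hab : a ≤ b)
    {A A' : ℝ → Matrix (Fin p) (Fin r) ℝ} {v v' : ℝ → Fin r → ℝ}
    (hA : ∀ x ∈ Icc a b, A x = A' x) (hv : ∀ x ∈ Icc a b, v x = v' x) :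
    (∫ x in a..b, A x *ᵥ v x) = ∫ x in a..b, A' x *ᵥ v' x := by
  refine intervalIntegral.integral_congr fun x hx => ?_
  rw [uIcc_of_le hab] at hx
  simp only [hA x hx, hv x hx]

theorem PI011K.IsCont.exists_isContinuous {p0 p1 r0 r1 : ℕ} {a b c d : ℝ} (hab : a ≤ b)
    (hcd : c ≤ d) {B : PI011K p0 p1 r0 r1} (hB : B.IsCont a b c d) :
    ∃ B' : PI011K p0 p1 r0 r1, B'.IsContinuous ∧
      ∀ f g : (Fin r0 → ℝ) × (ℝ → Fin r1 → ℝ) × (ℝ → Fin r1 → ℝ), TripleEqOn a b c d f g →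
        TripleEqOn a b c d (PI011 a b c d B f.1 f.2.1 f.2.2)
          (PI011 a b c d B' g.1 g.2.1 g.2.2) := by
  obtain ⟨h01, h02, h10, h20, h12, h21, h11, h22⟩ := hB
  obtain ⟨b01, hb01, e01⟩ := exists_continuous_eq_on_Icc hab h01
  obtain ⟨b02, hb02, e02⟩ := exists_continuous_eq_on_Icc hcd h02
  obtain ⟨b10, hb10, e10⟩ := exists_continuous_eq_on_Icc hab h10
  obtain ⟨b20, hb20, e20⟩ := exists_continuous_eq_on_Icc hcd h20
  obtain ⟨b12, hb12, e12⟩ := exists_continuous_eq_on_Icc₂ hab hcd h12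
  obtain ⟨b21, hb21, e21⟩ := exists_continuous_eq_on_Icc₂ hcd hab h21
  obtain ⟨b11, hb11, e11⟩ := h11.exists_isContinuous hab
  obtain ⟨b22, hb22, e22⟩ := h22.exists_isContinuous hcd
  refine ⟨⟨B.b00, b01, b02, b10, b20, b12, b21, b11, b22⟩,
    ⟨hb01, hb02, hb10, hb20, hb12, hb21, hb11, hb22⟩, fun f g ⟨h, h₁, h₂⟩ => ⟨?_, fun x hx => ?_,
    fun y hy => ?_⟩⟩
  · simp only [PI011, h, intervalIntegral_mulVec_congr hab e01 h₁,
      intervalIntegral_mulVec_congr hcd e02 h₂]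
  · simp only [PI011, h, e10 x hx, e11 _ _ h₁ x hx,
      intervalIntegral_mulVec_congr hcd (e12 x hx) h₂]
  · simp only [PI011, h, e20 y hy, e22 _ _ h₂ y hy,
      intervalIntegral_mulVec_congr hab (e21 y hy) h₁]

theorem PI2Dto011K.IsCont.exists_isContinuous {p0 p1 r : ℕ} {a b c d : ℝ} (hab : a ≤ b)
    (hcd : c ≤ d) {D : PI2Dto011K p0 p1 r} (hD : D.IsCont a b c d) :
    ∃ D' : PI2Dto011K p0 p1 r, D'.IsContinuous ∧ ∀ u u' : ℝ → ℝ → Fin r → ℝ,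
      (∀ x ∈ Icc a b, ∀ y ∈ Icc c d, u x y = u' x y) →
        TripleEqOn a b c d (PI2Dto011 a b c d D u) (PI2Dto011 a b c d D' u') := by
  obtain ⟨h0, h10, h11, h12, h20, h21, h22⟩ := hD
  obtain ⟨d0, hd0, e0⟩ := exists_continuous_eq_on_Icc₂ hab hcd h0
  obtain ⟨d10, hd10, e10⟩ := exists_continuous_eq_on_Icc₂ hab hcd h10
  obtain ⟨d11, hd11, e11⟩ := exists_continuous_eq_on_Icc₃ hab hcd hab h11
  obtain ⟨d12, hd12, e12⟩ := exists_continuous_eq_on_Icc₃ hab hcd hab h12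
  obtain ⟨d20, hd20, e20⟩ := exists_continuous_eq_on_Icc₂ hab hcd h20
  obtain ⟨d21, hd21, e21⟩ := exists_continuous_eq_on_Icc₃ hab hcd hcd h21
  obtain ⟨d22, hd22, e22⟩ := exists_continuous_eq_on_Icc₃ hab hcd hcd h22
  refine ⟨⟨d0, d10, d11, d12, d20, d21, d22⟩, ⟨hd0, hd10, hd11, hd12, hd20, hd21, hd22⟩,
    fun u u' hu => ⟨?_, fun x hx => stripOp_congr hcd hx e10 e11 e12 hu, fun y hy => ?_⟩⟩
  · refine intervalIntegral.integral_congr fun x hx => ?_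
    rw [uIcc_of_le hab] at hx
    exact intervalIntegral_mulVec_congr hcd (e0 x hx) (hu x hx)
  · exact stripOp_congr (K₀ := fun y x => D.d20 x y) (K₁ := fun y x ν => D.d21 x y ν)
      (K₂ := fun y x ν => D.d22 x y ν) (u := fun y x => u x y) hab hy
      (fun y hy x hx => e20 x hx y hy) (fun y hy x hx => e21 x hx y hy)
      (fun y hy x hx => e22 x hx y hy) (fun y hy x hx => hu x hx y hy)

theorem PI2Dto011_congr {p0 p1 r : ℕ} {a b c d : ℝ} (hab : a ≤ b) (hcd : c ≤ d)
    (D : PI2Dto011K p0 p1 r) {u u' : ℝ → ℝ → Fin r → ℝ}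
    (hu : ∀ x ∈ Icc a b, ∀ y ∈ Icc c d, u x y = u' x y) :
    TripleEqOn a b c d (PI2Dto011 a b c d D u) (PI2Dto011 a b c d D u') := by
  refine ⟨?_, fun x hx => stripOp_congr hcd hx (fun _ _ _ _ => rfl) (fun _ _ _ _ _ _ => rfl)
    (fun _ _ _ _ _ _ => rfl) hu, fun y hy => ?_⟩
  · refine intervalIntegral.integral_congr fun x hx => ?_
    rw [uIcc_of_le hab] at hx
    exact intervalIntegral_mulVec_congr hcd (fun _ _ => rfl) (hu x hx)
  · exact stripOp_congr (K₀ := fun y x => D.d20 x y) (K₁ := fun y x ν => D.d21 x y ν)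
      (K₂ := fun y x ν => D.d22 x y ν) (u := fun y x => u x y) hab hy
      (fun _ _ _ _ => rfl) (fun _ _ _ _ _ _ => rfl) (fun _ _ _ _ _ _ => rfl)
      (fun y hy x hx => hu x hx y hy)

/-- The kernels of the composition of a (2D→011)-PI operator and a 011-PI operator. -/
def PI011K.compKernels {n0 n1 p0 p1 r : ℕ} (a b c d : ℝ) (B : PI011K n0 n1 p0 p1)
    (D : PI2Dto011K p0 p1 r) : PI2Dto011K n0 n1 r :=
  let E₀ := fun y x => D.d20 x y
  let E₁ := fun y x ν => D.d21 x y ν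
  let E₂ := fun y x ν => D.d22 x y ν
  { d0 := fun x y => B.b00 * D.d0 x y +
      stripKernel a b B.b01 B.b01 B.b01 D.d10 D.d11 D.d12 b y x +
      stripKernel c d B.b02 B.b02 B.b02 E₀ E₁ E₂ d x y
    d10 := fun x y => B.b11.k0 x * D.d10 x y
    d11 := lineKernel a b c d B.b10 B.b11 B.b12 D.d0 D.d10 D.d11 D.d12 E₀ E₁ E₂ B.b11.k1 D.d11
    d12 := lineKernel a b c d B.b10 B.b11 B.b12 D.d0 D.d10 D.d11 D.d12 E₀ E₁ E₂ B.b11.k2 D.d12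
    d20 := fun x y => B.b22.k0 y * D.d20 x y
    d21 := fun x y ν => lineKernel c d a b B.b20 B.b22 B.b21 (fun y x => D.d0 x y) E₀ E₁ E₂
      D.d10 D.d11 D.d12 B.b22.k1 E₁ y x ν
    d22 := fun x y ν => lineKernel c d a b B.b20 B.b22 B.b21 (fun y x => D.d0 x y) E₀ E₁ E₂
      D.d10 D.d11 D.d12 B.b22.k2 E₂ y x ν }

section

variable {n0 n1 p0 p1 r : ℕ} {a b c d : ℝ} {B : PI011K n0 n1 p0 p1} {D : PI2Dto011K p0 p1 r}

set_option maxHeartbeats 1000000 in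
theorem PI011K.IsContinuous.compKernels (hB : B.IsContinuous) (hD : D.IsContinuous) :
    (B.compKernels a b c d D).IsContinuous := by
  obtain ⟨h01, h02, h10, h20, h12, h21, ⟨h110, h111, h112⟩, ⟨h220, h221, h222⟩⟩ := hB
  obtain ⟨hd0, hd10, hd11, hd12, hd20, hd21, hd22⟩ := hD
  have s : Continuous fun q : ℝ × ℝ => (q.2, q.1) := by fun_prop
  have s₃ : Continuous fun q : ℝ × ℝ × ℝ => (q.2.1, q.1, q.2.2) := by fun_prop
  have h0 : Continuous fun q : ℝ × ℝ => D.d0 q.2 q.1 := hd0.comp s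
  have e0 : Continuous fun q : ℝ × ℝ => D.d20 q.2 q.1 := hd20.comp s
  have e1 : Continuous fun q : ℝ × ℝ × ℝ => D.d21 q.2.1 q.1 q.2.2 := hd21.comp s₃
  have e2 : Continuous fun q : ℝ × ℝ × ℝ => D.d22 q.2.1 q.1 q.2.2 := hd22.comp s₃
  refine ⟨?_, ?_, ?_, ?_, ?_, ?_, ?_⟩
  · refine Continuous.add (Continuous.add (by fun_prop) ?_) ?_
    · exact continuous_stripKernel (A := fun _ : ℝ × ℝ => B.b01) (A₁ := fun _ => B.b01)
        (A₂ := fun _ => B.b01) (by fun_prop) (by fun_prop) (by fun_prop) hd10 hd11 hd12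
        (by fun_prop) (by fun_prop) (by fun_prop) a b
    · exact continuous_stripKernel (A := fun _ : ℝ × ℝ => B.b02) (A₁ := fun _ => B.b02)
        (A₂ := fun _ => B.b02) (by fun_prop) (by fun_prop) (by fun_prop) e0 e1 e2
        (by fun_prop) (by fun_prop) (by fun_prop) c d
  · exact (h110.comp continuous_fst).matrix_mul hd10
  · exact continuous_lineKernel h10 h110 h111 h112 h12 hd0 hd10 hd11 hd12 e0 e1 e2 h111 hd11 a b c d
  · exact continuous_lineKernel h10 h110 h111 h112 h12 hd0 hd10 hd11 hd12 e0 e1 e2 h112 hd12 a b c d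
  · exact (h220.comp continuous_snd).matrix_mul hd20
  · have L := continuous_lineKernel (M := B.b20) (N := B.b22) (C := B.b21)
      (D₀ := fun y x => D.d0 x y) (K₀ := fun y x => D.d20 x y)
      (K₁ := fun y x ν => D.d21 x y ν) (K₂ := fun y x ν => D.d22 x y ν) (A := B.b22.k1)
      (K := fun y x ν => D.d21 x y ν) h20 h220 h221 h222 h21 h0 e0 e1 e2 hd10 hd11 hd12 h221 e1
      c d a b
    exact L.comp s₃
  · have L := continuous_lineKernel (M := B.b20) (N := B.b22) (C := B.b21)
      (D₀ := fun y x => D.d0 x y) (K₀ := fun y x => D.d20 x y)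
      (K₁ := fun y x ν => D.d21 x y ν) (K₂ := fun y x ν => D.d22 x y ν) (A := B.b22.k2)
      (K := fun y x ν => D.d22 x y ν) h20 h220 h221 h222 h21 h0 e0 e1 e2 hd10 hd11 hd12 h222 e2
      c d a b
    exact L.comp s₃

theorem PI011_PI2Dto011 (hab : a ≤ b) (hcd : c ≤ d) (hB : B.IsContinuous) (hD : D.IsContinuous)
    {u : ℝ → ℝ → Fin r → ℝ} (hu : Continuous fun q : ℝ × ℝ => u q.1 q.2) :
    TripleEqOn a b c d
      (PI011 a b c d B (PI2Dto011 a b c d D u).1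
        (PI2Dto011 a b c d D u).2.1 (PI2Dto011 a b c d D u).2.2)
      (PI2Dto011 a b c d (B.compKernels a b c d D) u) := by
  obtain ⟨h01, h02, h10, h20, h12, h21, ⟨h110, h111, h112⟩, ⟨h220, h221, h222⟩⟩ := hB
  obtain ⟨hd0, hd10, hd11, hd12, hd20, hd21, hd22⟩ := hD
  have s : Continuous fun q : ℝ × ℝ => (q.2, q.1) := by fun_prop
  have s₃ : Continuous fun q : ℝ × ℝ × ℝ => (q.2.1, q.1, q.2.2) := by fun_prop
  have h0 : Continuous fun q : ℝ × ℝ => D.d0 q.2 q.1 := hd0.comp s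
  have e0 : Continuous fun q : ℝ × ℝ => D.d20 q.2 q.1 := hd20.comp s
  have e1 : Continuous fun q : ℝ × ℝ × ℝ => D.d21 q.2.1 q.1 q.2.2 := hd21.comp s₃
  have e2 : Continuous fun q : ℝ × ℝ × ℝ => D.d22 q.2.1 q.1 q.2.2 := hd22.comp s₃
  have hus : Continuous fun q : ℝ × ℝ => u q.2 q.1 := hu.comp s
  refine ⟨?_, fun x hx => ?_, fun y hy => ?_⟩
  · have hP : Continuous fun q : ℝ × ℝ =>
        stripKernel a b B.b01 B.b01 B.b01 D.d10 D.d11 D.d12 b q.2 q.1 :=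
      continuous_stripKernel (A := fun _ => B.b01) (A₁ := fun _ => B.b01)
        (A₂ := fun _ => B.b01) (by fun_prop) (by fun_prop) (by fun_prop) hd10 hd11 hd12
        (by fun_prop) (by fun_prop) (by fun_prop) a b
    have hQ : Continuous fun q : ℝ × ℝ =>
        stripKernel c d B.b02 B.b02 B.b02 (fun y x => D.d20 x y) (fun y x ν => D.d21 x y ν)
          (fun y x ν => D.d22 x y ν) d q.1 q.2 :=
      continuous_stripKernel (A := fun _ => B.b02) (A₁ := fun _ => B.b02)
        (A₂ := fun _ => B.b02) (by fun_prop) (by fun_prop) (by fun_prop) e0 e1 e2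
        (by fun_prop) (by fun_prop) (by fun_prop) c d
    have l₀ : B.b00 *ᵥ (PI2Dto011 a b c d D u).1 =
        ∫ x in a..b, ∫ y in c..d, (B.b00 * D.d0 x y) *ᵥ u x y := by
      refine (mulVec_intervalIntegral _ (Continuous.intervalIntegrable (by fun_prop) _ _)).trans
        (intervalIntegral.integral_congr fun x _ => ?_)
      simp only [← mulVec_mulVec]
      exact mulVec_intervalIntegral _ (Continuous.intervalIntegrable (by fun_prop) _ _)
    have l₁ := (intervalIntegral_mulVec_stripOp_self (c := c) (d := d) hab h01 hd10 hd11 hd12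
      hu).trans (intervalIntegral_swap_of_continuous (f := fun x y =>
        stripKernel a b B.b01 B.b01 B.b01 D.d10 D.d11 D.d12 b y x *ᵥ u x y)
        (hP.matrix_mulVec hu) a b c d).symm
    have l₂ := intervalIntegral_mulVec_stripOp_self (c := a) (d := b) (A := B.b02)
      (K₀ := fun y x => D.d20 x y) (K₁ := fun y x ν => D.d21 x y ν)
      (K₂ := fun y x ν => D.d22 x y ν) (u := fun y x => u x y) hcd h02 e0 e1 e2 hus
    have hf₀ : Continuous fun q : ℝ × ℝ => (B.b00 * D.d0 q.1 q.2) *ᵥ u q.1 q.2 := by fun_prop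
    have hf₁ := hP.matrix_mulVec hu
    have hf₂ := hQ.matrix_mulVec hu
    have integral_add {f g : ℝ → ℝ → Fin n0 → ℝ} (hf : Continuous fun q : ℝ × ℝ => f q.1 q.2)
        (hg : Continuous fun q : ℝ × ℝ => g q.1 q.2) :
        (∫ x in a..b, ∫ y in c..d, f x y) + (∫ x in a..b, ∫ y in c..d, g x y) =
          ∫ x in a..b, ∫ y in c..d, (f x y + g x y) := by
      rw [← intervalIntegral.integral_add]
      · refine intervalIntegral.integral_congr fun x _ => ?_
        exact (intervalIntegral.integral_add (Continuous.intervalIntegrable (by fun_prop) _ _)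
          (Continuous.intervalIntegrable (by fun_prop) _ _)).symm
      all_goals exact Continuous.intervalIntegrable (by fun_prop) _ _
    refine (congrArg₂ (· + ·) (congrArg₂ (· + ·) l₀ l₁) l₂).trans ?_
    refine ((congrArg (· + _) (integral_add hf₀ hf₁)).trans
      (integral_add (hf₀.add hf₁) hf₂)).trans ?_
    simp only [PI2Dto011, PI011K.compKernels, add_mulVec]
  · rw [show (PI2Dto011 a b c d D u).1 = _ from
      intervalIntegral_swap_of_continuous (Continuous.matrix_mulVec hd0 hu) a b c d]
    exact component_comp_eq_stripOp (L₀ := fun y x => D.d20 x y) (L₁ := fun y x ν => D.d21 x y ν)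
      (L₂ := fun y x ν => D.d22 x y ν) hx hcd h111 h112 h12 hd0 hd10 hd11 hd12 e0 e1 e2 hu
  · exact (add_right_comm _ _ _).trans
      (component_comp_eq_stripOp (M := B.b20) (D₀ := fun y x => D.d0 x y)
        (K₀ := fun y x => D.d20 x y) (K₁ := fun y x ν => D.d21 x y ν)
        (K₂ := fun y x ν => D.d22 x y ν) (u := fun y x => u x y) hy hab h221 h222 h21 h0 e0 e1 e2
        hd10 hd11 hd12 hus)

end

/-- Composition of a (2D→011)-PI operator followed by a 011-PI operator
is a (2D→011)-PI operator. -/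
theorem composition_011_after_2Dto011 {n0 n1 p0 p1 m2 : ℕ} (a b c d : ℝ)
    (hab : a < b) (hcd : c < d)
    (B : PI011K n0 n1 p0 p1) (D : PI2Dto011K p0 p1 m2)
    (hB : B.IsCont a b c d) (hD : D.IsCont a b c d) :
    ∃ S : PI2Dto011K n0 n1 m2, S.IsCont a b c d ∧
      ∀ u : ℝ → ℝ → Fin m2 → ℝ,
        ContinuousOn (fun q : ℝ × ℝ => u q.1 q.2) (Icc a b ×ˢ Icc c d) →
        (PI011 a b c d B (PI2Dto011 a b c d D u).1
            (PI2Dto011 a b c d D u).2.1 (PI2Dto011 a b c d D u).2.2).1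
          = (PI2Dto011 a b c d S u).1 ∧
        (∀ x ∈ Icc a b,
          (PI011 a b c d B (PI2Dto011 a b c d D u).1
              (PI2Dto011 a b c d D u).2.1 (PI2Dto011 a b c d D u).2.2).2.1 x
            = (PI2Dto011 a b c d S u).2.1 x) ∧
        (∀ y ∈ Icc c d,
          (PI011 a b c d B (PI2Dto011 a b c d D u).1
              (PI2Dto011 a b c d D u).2.1 (PI2Dto011 a b c d D u).2.2).2.2 y
            = (PI2Dto011 a b c d S u).2.2 y) := by
  obtain ⟨B', hB', eB⟩ := hB.exists_isContinuous hab.le hcd.le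
  obtain ⟨D', hD', eD⟩ := hD.exists_isContinuous hab.le hcd.le
  refine ⟨B'.compKernels a b c d D', (hB'.compKernels hD').isCont a b c d, fun u hu => ?_⟩
  obtain ⟨u', hu', eu⟩ := exists_continuous_eq_on_Icc₂ hab.le hcd.le hu
  have eS (x : ℝ) (hx : x ∈ Icc a b) (y : ℝ) (hy : y ∈ Icc c d) : u' x y = u x y :=
    (eu x hx y hy).symm
  exact (eB _ _ (eD u u' eu)).trans <|
    (PI011_PI2Dto011 hab.le hcd.le hB' hD' hu').trans (PI2Dto011_congr hab.le hcd.le _ eS)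
end
end
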